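/- arXiv:math/0701836 — 3 statements merged into one kernel-verified Lean document; each statement's English description precedes it below -/
import Mathlib

section
/- For a positive integer r set Λ(r) = (1 − q^{−1})(1 − q^{−2})⋯(1 − q^{−r}) ∈ ℚ, and Λ(0) = 1. Let a(n) be the number of n-element subsets S ⊆ ℙ^N(k̄) with σ(S) = S. Then for every n > N + 1: a(n) = Σ_{N/2 < i ≤ N} ((−1)^{N−i} Λ(2i) / (Λ(2i − N − 1) Λ(i) Λ(N − i))) · q^{i n − (N−i)(N−i+1)/2}. -/
/-- The `q`-power Frobenius acting on `ℙ^{m-1}(k̄)` (raising homogeneous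
coordinates to the `q`-th power), where `q = |k|`. -/
noncomputable def projFrob (k : Type*) [Field k] [Fintype k] (m : ℕ) :
    Projectivization (AlgebraicClosure k) (Fin m → AlgebraicClosure k) →
    Projectivization (AlgebraicClosure k) (Fin m → AlgebraicClosure k) :=
  fun P => Projectivization.mk (AlgebraicClosure k)
    (fun i => (P.rep i) ^ (Fintype.card k)) (by
      intro h
      apply P.rep_nonzero
      funext i
      have hi : P.rep i ^ (Fintype.card k) = 0 := by simpa using congrFun h i
      simpa using pow_eq_zero_iff (Fintype.card_ne_zero (α := k)) |>.mp hi)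

/-- The number of `n`-element subsets `S` of `A ⊆ X` with `σ(S) = S`. -/
noncomputable def nSetCount {X : Type*} (σ : X → X) (A : Set X) (n : ℕ) : ℕ :=
  Set.ncard {S : Set X | S ⊆ A ∧ S.Finite ∧ S.ncard = n ∧ σ '' S = S}

/-- `Λ(r) = (1 − q⁻¹)(1 − q⁻²)⋯(1 − q⁻ʳ)`, with `Λ(0) = 1`. -/
noncomputable def Lam (q : ℕ) (r : ℕ) : ℚ :=
  ∏ i ∈ Finset.range r, (1 - ((q : ℚ))⁻¹ ^ (i + 1))

section Combi
open Function Finset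

/-- signed weight -/
def wt (d r : ℕ) : ℚ := if d ∣ r then (-1) ^ (r / d + 1) else 0

lemma wt_eq (d r : ℕ) (hd : 0 < d) :
    wt d r = (if d ∣ r then 1 else 0) - 2 * (if 2 ∣ r ∧ d ∣ r / 2 then 1 else 0) := by
  unfold wt
  by_cases h : d ∣ r
  · obtain ⟨e, rfl⟩ := h
    rw [if_pos (dvd_mul_right _ _), if_pos (dvd_mul_right _ _), Nat.mul_div_cancel_left _ hd]
    rcases Nat.even_or_odd' e with ⟨f, rfl | rfl⟩
    · have h1 : d * (2 * f) = 2 * (d * f) := by ring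
      rw [if_pos]
      · rw [pow_succ, pow_mul]; norm_num
      · rw [h1]; simp
    · rw [if_neg]
      · have : 2 * f + 1 + 1 = 2 * (f + 1) := by ring
        rw [this, pow_mul]; norm_num
      · rintro ⟨⟨u, hu⟩, h2⟩
        rw [hu, Nat.mul_div_cancel_left _ (by norm_num)] at h2
        obtain ⟨v, rfl⟩ := h2
        have : d * (2 * f + 1) = d * (2 * v) := by rw [hu]; ring
        have := Nat.eq_of_mul_eq_mul_left hd this
        omega
  · rw [if_neg h, if_neg h, if_neg]
    · simp
    · rintro ⟨⟨u, rfl⟩, h2⟩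
      rw [Nat.mul_div_cancel_left _ (by norm_num)] at h2
      exact h (h2.mul_left 2)

/-- alternating recursion solved -/
lemma solve_rec (d : ℕ) (hd : 0 < d) (n : ℕ) (a c : ℕ → ℚ) (h0 : ∀ m < d, c m = 0)
    (h1 : ∀ m, m + d ≤ n → c (m + d) + c m = a m) :
    ∀ m ≤ n, c m = ∑ r ∈ Icc 1 m, wt d r * a (m - r) := by
  intro m
  induction m using Nat.strong_induction_on with
  | _ m ih =>
    intro hm
    by_cases hmd : m < d
    · rw [h0 m hmd]
      symm
      apply Finset.sum_eq_zero
      intro r hr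
      rw [mem_Icc] at hr
      have : ¬ d ∣ r := fun h => by have := Nat.le_of_dvd (by omega) h; omega
      simp [wt, this]
    · obtain ⟨l, rfl⟩ : ∃ l, m = l + d := ⟨m - d, by omega⟩
      have e := h1 l hm
      rw [ih l (by omega) (by omega)] at e
      have e2 : ∑ r ∈ Icc 1 (l + d), wt d r * a (l + d - r) =
          ∑ r ∈ Icc d (l + d), wt d r * a (l + d - r) := by
        symm
        apply Finset.sum_subset
        · intro x; simp only [mem_Icc]; omega
        · intro x hx hx'
          simp only [mem_Icc] at hx hx'
          have : ¬ d ∣ x := fun h => by have := Nat.le_of_dvd (by omega) h; omega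
          simp [wt, this]
      have e3 : ∑ r ∈ Icc d (l + d), wt d r * a (l + d - r) =
          ∑ r ∈ Icc 0 l, wt d (r + d) * a (l - r) := by
        have hs := Finset.sum_image (s := Icc 0 l) (g := fun r => r + d)
          (f := fun r => wt d r * a (l + d - r)) (by intro x _ y _ h; simpa using h)
        have hi : (Icc 0 l).image (fun r => r + d) = Icc d (l + d) := by
          ext x; simp only [mem_image, mem_Icc]
          constructor
          · rintro ⟨y, h, rfl⟩; omega
          · intro h; exact ⟨x - d, by omega, by omega⟩
        rw [hi] at hs
        rw [hs]
        apply Finset.sum_congr rfl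
        intro r _
        rw [Nat.add_sub_add_right]
      have e4 : ∑ r ∈ Icc 0 l, wt d (r + d) * a (l - r) =
          wt d d * a l + ∑ r ∈ Icc 1 l, wt d (r + d) * a (l - r) := by
        rw [← Finset.add_sum_Ioc_eq_sum_Icc (Nat.zero_le l)]
        simp
        rfl
      have e5 : ∀ r, wt d (r + d) = - wt d r := by
        intro r
        unfold wt
        simp only [Nat.dvd_add_self_right]
        split_ifs with h
        · rw [Nat.add_div_right _ hd]; rw [pow_succ]; simp
        · simp
      rw [e2, e3, e4]
      simp only [e5, neg_mul, Finset.sum_neg_distrib]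
      have : wt d d = 1 := by simp [wt, Nat.div_self hd]
      rw [this]
      linarith

variable {X : Type*} (σ : X → X)

open Classical in
lemma stable_iter {S : Finset X} (hS : S.image σ = S) {x : X} (hx : x ∈ S) (i : ℕ) :
    σ^[i] x ∈ S := by
  induction i with
  | zero => simpa
  | succ i ih =>
    rw [Function.iterate_succ_apply', ← hS]
    exact mem_image_of_mem _ ih

open Classical in
lemma stable_injOn {S : Finset X} (hS : S.image σ = S) : Set.InjOn σ S :=
  Finset.card_image_iff.1 (by rw [hS])

open Classical in
lemma stable_period {S : Finset X} (hS : S.image σ = S) {x : X} (hx : x ∈ S) :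
    0 < minimalPeriod σ x ∧ minimalPeriod σ x ≤ S.card := by
  have hinj : ∀ i, Set.InjOn (σ^[i]) S := by
    intro i
    apply Set.InjOn.iterate (stable_injOn σ hS)
    intro y hy
    exact stable_iter σ hS hy 1
  obtain ⟨i, hi, j, hj, hij, h⟩ := Finset.exists_ne_map_eq_of_card_lt_of_maps_to
    (s := range (S.card + 1)) (t := S) (by simp) (f := fun i => σ^[i] x)
    (fun i _ => stable_iter σ hS hx i)
  simp only [mem_range] at hi hj h
  have key : ∀ i j, i < j → j < S.card + 1 → σ^[i] x = σ^[j] x →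
      0 < minimalPeriod σ x ∧ minimalPeriod σ x ≤ S.card := by
    intro i j hij hj h
    have hp : IsPeriodicPt σ (j - i) x := by
      have : j = i + (j - i) := by omega
      rw [this, Function.iterate_add_apply] at h
      exact (hinj i hx (stable_iter σ hS hx _) h).symm
    exact ⟨hp.minimalPeriod_pos (by omega), (hp.minimalPeriod_le (by omega)).trans (by omega)⟩
  rcases lt_or_gt_of_ne hij with h' | h'
  · exact key i j h' hj h
  · exact key j i h' hi h.symm

open Classical in
/-- the orbit of a point -/
noncomputable def orb (x : X) : Finset X := (range (minimalPeriod σ x)).image (fun i => σ^[i] x)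

lemma orb_card (x : X) : (orb σ x).card = minimalPeriod σ x := by
  classical
  unfold orb
  rw [Finset.card_image_of_injOn, card_range]
  simpa using iterate_injOn_Iio_minimalPeriod

open Classical in
lemma orb_stable {x : X} (hx : 0 < minimalPeriod σ x) : (orb σ x).image σ = orb σ x := by
  have hsub : (orb σ x).image σ ⊆ orb σ x := by
    intro y hy
    simp only [orb, mem_image, mem_range] at hy ⊢
    obtain ⟨_, ⟨i, hi, rfl⟩, rfl⟩ := hy
    refine ⟨(i + 1) % minimalPeriod σ x, Nat.mod_lt _ hx, ?_⟩
    rw [iterate_mod_minimalPeriod_eq, Function.iterate_succ_apply']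
  refine hsub.antisymm ?_
  intro y hy
  simp only [orb, mem_image, mem_range] at hy ⊢
  obtain ⟨i, hi, rfl⟩ := hy
  refine ⟨_, ⟨(i + (minimalPeriod σ x - 1)) % minimalPeriod σ x, Nat.mod_lt _ hx, rfl⟩, ?_⟩
  rw [iterate_mod_minimalPeriod_eq, ← Function.iterate_succ_apply' σ]
  have : (i + (minimalPeriod σ x - 1)).succ = i + minimalPeriod σ x := by omega
  rw [this, iterate_add_minimalPeriod_eq]

lemma self_mem_orb {x : X} (hx : 0 < minimalPeriod σ x) : x ∈ orb σ x := by
  classical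
  simp only [orb, mem_image, mem_range]
  exact ⟨0, hx, rfl⟩

open Classical in
lemma orb_subset {S : Finset X} (hS : S.image σ = S) {x : X} (hx : x ∈ S) : orb σ x ⊆ S := by
  intro y hy
  simp only [orb, mem_image, mem_range] at hy
  obtain ⟨i, hi, rfl⟩ := hy
  exact stable_iter σ hS hx i

/-- If an orbit point lies in a stable set so does the base point. -/
lemma mem_of_orb {S : Finset X} [DecidableEq X] (hS : S.image σ = S) {x y : X} (hy : y ∈ orb σ x) (hyS : y ∈ S) :
    x ∈ S := by
  classical
  simp only [orb, mem_image, mem_range] at hy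
  obtain ⟨i, hi, rfl⟩ := hy
  have := stable_iter (x := σ^[i] x) σ (by convert hS) hyS (minimalPeriod σ x - i)
  rw [← Function.iterate_add_apply, Nat.sub_add_cancel hi.le, iterate_minimalPeriod] at this
  exact this

open Classical in
/-- stable subsets of `P` of size `m`. -/
noncomputable def stab (P : Finset X) (m : ℕ) : Finset (Finset X) :=
  P.powerset.filter (fun S => S.card = m ∧ S.image σ = S)

open Classical in
lemma mem_stab {P : Finset X} {m : ℕ} {S : Finset X} :
    S ∈ stab σ P m ↔ S ⊆ P ∧ S.card = m ∧ S.image σ = S := by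
  simp [stab]

open Classical in
lemma stab_shift (P : Finset X) (n : ℕ)
    (hP : ∀ x, x ∈ P ↔ 0 < minimalPeriod σ x ∧ minimalPeriod σ x ≤ n) (x : X) (hx : x ∈ P) (m : ℕ) :
    ((stab σ P (m + minimalPeriod σ x)).filter (x ∈ ·)).card +
      ((stab σ P m).filter (x ∈ ·)).card = (stab σ P m).card := by
  have hpos := ((hP x).1 hx).1
  have hle := ((hP x).1 hx).2
  have hO := orb_stable σ hpos
  rw [← Finset.card_filter_add_card_filter_not (s := stab σ P m) (fun S => x ∈ S), add_comm]
  congr 1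
  refine Finset.card_bij' (fun S _ => S \ orb σ x) (fun S _ => S ∪ orb σ x) ?_ ?_ ?_ ?_
  · intro S hS
    simp only [mem_filter, mem_stab] at hS ⊢
    obtain ⟨⟨h1, h2, h3⟩, h4⟩ := hS
    have hsub := orb_subset σ h3 h4
    refine ⟨⟨(sdiff_subset).trans h1, ?_, ?_⟩, ?_⟩
    · rw [card_sdiff_of_subset hsub, orb_card, h2]; omega
    · rw [Finset.image_sdiff_of_injOn (stable_injOn σ h3) hsub, h3, hO]
    · simp [self_mem_orb σ hpos]
  · intro S hS
    simp only [mem_filter, mem_stab] at hS ⊢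
    obtain ⟨⟨h1, h2, h3⟩, h4⟩ := hS
    refine ⟨⟨union_subset h1 ?_, ?_, ?_⟩, ?_⟩
    · intro y hy
      rw [hP]
      have := stable_period σ hO hy
      rw [orb_card] at this
      exact ⟨this.1, this.2.trans hle⟩
    · rw [card_union_of_disjoint, orb_card, h2]
      rw [Finset.disjoint_right]
      intro y hy hyS
      exact h4 (mem_of_orb σ h3 hy hyS)
    · rw [image_union, h3, hO]
    · simp [self_mem_orb σ hpos]
  · intro S hS
    simp only [mem_filter, mem_stab] at hS
    obtain ⟨⟨h1, h2, h3⟩, h4⟩ := hS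
    exact sdiff_union_of_subset (orb_subset σ h3 h4)
  · intro S hS
    simp only [mem_filter, mem_stab] at hS
    obtain ⟨⟨h1, h2, h3⟩, h4⟩ := hS
    apply union_sdiff_cancel_right
    rw [Finset.disjoint_right]
    intro y hy hyS
    exact h4 (mem_of_orb σ h3 hy hyS)

open Classical in
lemma stab_eq_count (P : Finset X) (n : ℕ)
    (hP : ∀ x, x ∈ P ↔ 0 < minimalPeriod σ x ∧ minimalPeriod σ x ≤ n) (m : ℕ) (hm : m ≤ n) :
    nSetCount σ Set.univ m = (stab σ P m).card := by
  unfold nSetCount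
  rw [← Set.ncard_coe_finset]
  symm
  apply Set.ncard_congr (fun (S : Finset X) _ => (S : Set X))
  · intro S hS
    rw [Finset.mem_coe, mem_stab] at hS
    refine ⟨Set.subset_univ _, S.finite_toSet, by rw [Set.ncard_coe_finset]; exact hS.2.1, ?_⟩
    rw [← Finset.coe_image, hS.2.2]
  · intro S T _ _ h
    exact Finset.coe_injective h
  · rintro S ⟨-, hf, hc, hs⟩
    lift S to Finset X using hf
    have hs' : S.image σ = S := by
      apply Finset.coe_injective; rw [Finset.coe_image]; exact hs
    rw [Set.ncard_coe_finset] at hc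
    refine ⟨S, ?_, rfl⟩
    rw [Finset.mem_coe, mem_stab]
    refine ⟨?_, hc, hs'⟩
    intro x hx
    rw [hP]
    have := stable_period σ hs' hx
    omega

lemma count_rec (hfin : ∀ r, r ≠ 0 → {x | σ^[r] x = x}.Finite) (n : ℕ) :
    (n : ℚ) * nSetCount σ Set.univ n = ∑ r ∈ Icc 1 n,
      (({x | σ^[r] x = x}.ncard : ℚ) - 2 * (if 2 ∣ r then ({x | σ^[r / 2] x = x}.ncard : ℚ) else 0))
        * nSetCount σ Set.univ (n - r) := by
  classical
  have hPfin : {x | 0 < minimalPeriod σ x ∧ minimalPeriod σ x ≤ n}.Finite := by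
    apply Set.Finite.subset (Set.Finite.biUnion (Set.finite_Icc 1 n)
      (t := fun r => {x | σ^[r] x = x}) (fun r hr => hfin r (by have := hr.1; omega)))
    intro x hx
    simp only [Set.mem_iUnion]
    exact ⟨minimalPeriod σ x, ⟨hx.1, hx.2⟩, iterate_minimalPeriod⟩
  set P := hPfin.toFinset with hPdef
  have hP : ∀ x, x ∈ P ↔ 0 < minimalPeriod σ x ∧ minimalPeriod σ x ≤ n := by simp [hPdef]
  have hcnt : ∀ r, 1 ≤ r → r ≤ n → ∑ x ∈ P, (if minimalPeriod σ x ∣ r then (1 : ℚ) else 0) =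
      {x | σ^[r] x = x}.ncard := by
    intro r h1 h2
    rw [Finset.sum_boole, ← Set.ncard_coe_finset]
    congr 2
    ext x
    simp only [coe_filter, Set.mem_ofPred_eq, hP]
    rw [← isPeriodicPt_iff_minimalPeriod_dvd]
    constructor
    · exact fun h => h.2
    · intro h
      have h : IsPeriodicPt σ r x := h
      exact ⟨⟨h.minimalPeriod_pos h1, (h.minimalPeriod_le h1).trans h2⟩, h⟩
  have hdouble : (n : ℚ) * (stab σ P n).card = ∑ x ∈ P, (((stab σ P n).filter (x ∈ ·)).card : ℚ) := by
    have h1 : ∑ x ∈ P, ((stab σ P n).filter (x ∈ ·)).card = ∑ S ∈ stab σ P n, (P.filter (· ∈ S)).card :=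
      Finset.sum_card_bipartiteAbove_eq_sum_card_bipartiteBelow (fun x S => x ∈ S)
    have h2 : ∑ S ∈ stab σ P n, (P.filter (· ∈ S)).card = ∑ S ∈ stab σ P n, n := by
      apply Finset.sum_congr rfl
      intro S hS
      rw [mem_stab] at hS
      rw [Finset.filter_mem_eq_inter, Finset.inter_eq_right.2 hS.1, hS.2.1]
    rw [h2] at h1
    simp only [sum_const, smul_eq_mul] at h1
    rw [mul_comm]
    exact_mod_cast h1.symm
  have hc : ∀ x ∈ P, (((stab σ P n).filter (x ∈ ·)).card : ℚ) =
      ∑ r ∈ Icc 1 n, wt (minimalPeriod σ x) r * (stab σ P (n - r)).card := by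
    intro x hx
    refine solve_rec (minimalPeriod σ x) ((hP x).1 hx).1 n (fun m => (stab σ P m).card)
      (fun m => ((stab σ P m).filter (x ∈ ·)).card) ?_ ?_ n le_rfl
    · intro m hm
      simp only [Nat.cast_eq_zero, Finset.card_eq_zero, Finset.filter_eq_empty_iff, mem_stab]
      rintro S ⟨h1, h2, h3⟩ h4
      have := stable_period σ h3 h4
      omega
    · intro m _
      exact_mod_cast stab_shift σ P n hP x hx m
  rw [stab_eq_count σ P n hP n le_rfl, hdouble, Finset.sum_congr rfl hc, Finset.sum_comm]
  apply Finset.sum_congr rfl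
  intro r hr
  rw [mem_Icc] at hr
  rw [stab_eq_count σ P n hP (n - r) (by omega), ← Finset.sum_mul]
  congr 1
  rw [Finset.sum_congr rfl (fun x hx => wt_eq _ r ((hP x).1 hx).1), Finset.sum_sub_distrib,
    ← Finset.mul_sum, hcnt r hr.1 hr.2]
  congr 2
  split_ifs with h
  · simp only [h, true_and]
    exact hcnt (r / 2) (by omega) (by omega)
  · simp [h]

lemma count_zero : nSetCount σ Set.univ 0 = 1 := by
  unfold nSetCount
  rw [Set.ncard_eq_one]
  refine ⟨∅, ?_⟩
  ext S
  simp only [Set.mem_ofPred_eq, Set.mem_singleton_iff]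
  constructor
  · rintro ⟨-, hf, hc, -⟩
    exact (Set.ncard_eq_zero hf).1 hc
  · rintro rfl
    simp
end Combi
section FixedPoints
open Polynomial

lemma projFrob_mk (k : Type*) [Field k] [Fintype k] (m : ℕ) (v : Fin m → AlgebraicClosure k)
    (hv : v ≠ 0) (hv' : (fun i => v i ^ Fintype.card k) ≠ 0) :
    projFrob k m (Projectivization.mk _ v hv) =
      Projectivization.mk _ (fun i => v i ^ Fintype.card k) hv' := by
  unfold projFrob
  rw [Projectivization.mk_eq_mk_iff']
  obtain ⟨a, ha⟩ := Projectivization.exists_smul_eq_mk_rep (AlgebraicClosure k) v hv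
  refine ⟨(a : AlgebraicClosure k) ^ Fintype.card k, ?_⟩
  funext i
  rw [← ha]
  simp [Units.smul_def, mul_pow]

lemma pow_fun_ne_zero {L : Type*} [Field L] {m : ℕ} {v : Fin m → L} (hv : v ≠ 0) (Q : ℕ) :
    (fun i => v i ^ Q) ≠ 0 := by
  obtain ⟨i, hi⟩ := Function.ne_iff.mp hv
  exact Function.ne_iff.mpr ⟨i, pow_ne_zero _ hi⟩

lemma projFrob_iterate_mk (k : Type*) [Field k] [Fintype k] (m r : ℕ)
    (v : Fin m → AlgebraicClosure k) (hv : v ≠ 0) :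
    (projFrob k m)^[r] (Projectivization.mk _ v hv) =
      Projectivization.mk _ (fun i => v i ^ (Fintype.card k ^ r)) (pow_fun_ne_zero hv _) := by
  induction r with
  | zero => simp
  | succ r ih =>
    rw [Function.iterate_succ_apply', ih, projFrob_mk _ _ _ _ (pow_fun_ne_zero (pow_fun_ne_zero hv _) _)]
    congr 1
    funext i
    rw [← pow_mul, pow_succ]

/-- The subfield of fixed elements of the `r`-th iterate of Frobenius. -/
noncomputable def fixK (k : Type*) [Field k] [Fintype k] (r : ℕ) : Subfield (AlgebraicClosure k) :=
  RingHom.eqLocusField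
    ((FiniteField.frobeniusAlgHom k (AlgebraicClosure k) ^ r :
      AlgebraicClosure k →ₐ[k] AlgebraicClosure k) : AlgebraicClosure k →+* AlgebraicClosure k)
    (RingHom.id _)

lemma mem_fixK (k : Type*) [Field k] [Fintype k] (r : ℕ) (x : AlgebraicClosure k) :
    x ∈ fixK k r ↔ x ^ (Fintype.card k ^ r) = x := by
  have : ∀ x, (FiniteField.frobeniusAlgHom k (AlgebraicClosure k) ^ r) x
      = x ^ (Fintype.card k ^ r) := by
    intro x
    induction r with
    | zero => simp
    | succ r ih => rw [pow_succ', AlgHom.mul_apply, ih, FiniteField.frobeniusAlgHom_apply, ← pow_mul, pow_succ]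
  unfold fixK
  rw [RingHom.mem_eqLocusField]
  simp [this]

lemma card_fixK (k : Type*) [Field k] [Fintype k] (r : ℕ) (hr : r ≠ 0) :
    Nat.card (fixK k r) = Fintype.card k ^ r := by
  classical
  obtain ⟨p, hp⟩ := CharP.exists k
  have hpd : p ∣ Fintype.card k ^ r := by
    refine dvd_pow ?_ hr
    rw [← CharP.cast_eq_zero_iff k p]; simp
  have h1 : 1 < Fintype.card k := Fintype.one_lt_card
  have hne : (X ^ Fintype.card k ^ r - X : k[X]) ≠ 0 :=
    FiniteField.X_pow_card_pow_sub_X_ne_zero _ hr h1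
  have h2 := card_rootSet_eq_natDegree (K := AlgebraicClosure k)
    (galois_poly_separable (K := k) p _ hpd) (IsAlgClosed.splits _)
  rw [FiniteField.X_pow_card_pow_sub_X_natDegree_eq _ hr h1] at h2
  rw [← h2, ← Nat.card_eq_fintype_card]
  apply Nat.card_congr
  refine Equiv.subtypeEquivRight ?_
  intro x
  rw [mem_fixK, mem_rootSet_of_ne hne]
  simp [sub_eq_zero]

/-- Coordinatewise inclusion. -/
noncomputable def inclK (k : Type*) [Field k] [Fintype k] (r m : ℕ) :
    (Fin m → fixK k r) →ₛₗ[(fixK k r).subtype] (Fin m → AlgebraicClosure k) where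
  toFun v i := v i
  map_add' _ _ := by funext i; simp
  map_smul' _ _ := by funext i; simp

lemma inclK_inj (k : Type*) [Field k] [Fintype k] (r m : ℕ) :
    Function.Injective (inclK k r m) := by
  intro u v h
  funext i
  exact Subtype.ext (congrFun h i)

lemma fix_card (k : Type*) [Field k] [Fintype k] (r m : ℕ) (hr : r ≠ 0) :
    {P | (projFrob k m)^[r] P = P}.Finite ∧
    {P | (projFrob k m)^[r] P = P}.ncard = ∑ i ∈ Finset.range m, (Fintype.card k ^ r) ^ i := by
  have hfin : Finite (fixK k r) := by
    apply Nat.finite_of_card_ne_zero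
    rw [card_fixK k r hr]
    exact pow_ne_zero _ Fintype.card_ne_zero
  have hfinP : Finite (Projectivization (fixK k r) (Fin m → fixK k r)) :=
    (Projectivization.finite_iff_of_finite _ _).2 inferInstance
  have hcard := Projectivization.card_of_finrank (fixK k r) (Fin m → fixK k r)
    (n := m) (by simp)
  rw [card_fixK k r hr] at hcard
  have hrange : {P | (projFrob k m)^[r] P = P} =
      Set.range (Projectivization.map (inclK k r m) (inclK_inj k r m)) := by
    ext P
    induction P using Projectivization.ind with | h v hv =>
    rw [Set.mem_ofPred_eq, projFrob_iterate_mk, Projectivization.mk_eq_mk_iff']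
    constructor
    · rintro ⟨a, ha⟩
      obtain ⟨j, hj⟩ := Function.ne_iff.mp hv
      have hj : v j ≠ 0 := hj
      have hmem : ∀ i, v i / v j ∈ fixK k r := by
        intro i
        rw [mem_fixK, div_pow, ← congrFun ha i, ← congrFun ha j]
        have ha0 : a ≠ 0 := by
          rintro rfl
          have := congrFun ha j
          simp at this
          exact pow_ne_zero _ hj this.symm
        simp only [Pi.smul_apply, smul_eq_mul]
        field_simp
      refine ⟨Projectivization.mk _ (fun i => ⟨v i / v j, hmem i⟩) ?_, ?_⟩
      · refine Function.ne_iff.mpr ⟨j, ?_⟩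
        intro h
        have := congrArg Subtype.val h
        simp [hj] at this
      · rw [Projectivization.map_mk, Projectivization.mk_eq_mk_iff']
        refine ⟨(v j)⁻¹, ?_⟩
        funext i
        simp [inclK, div_eq_inv_mul]
    · rintro ⟨R, hR⟩
      induction R using Projectivization.ind with | h w hw =>
      rw [Projectivization.map_mk, Projectivization.mk_eq_mk_iff'] at hR
      obtain ⟨a, ha⟩ := hR
      have hw' : ∀ i, (w i : AlgebraicClosure k) = a * v i := fun i => (congrFun ha i).symm
      have ha0 : a ≠ 0 := by
        rintro rfl
        apply hw
        funext i
        exact Subtype.ext (by simp [hw'])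
      refine ⟨a / a ^ (Fintype.card k ^ r), ?_⟩
      funext i
      have := (mem_fixK k r _).1 (w i).2
      rw [hw', mul_pow] at this
      simp only [Pi.smul_apply, smul_eq_mul]
      field_simp
      exact this.symm
  have hinj : Function.Injective (Projectivization.map (inclK k r m) (inclK_inj k r m)) := by
    intro u v h
    induction u using Projectivization.ind with | h u hu =>
    induction v using Projectivization.ind with | h v hv =>
    rw [Projectivization.map_mk, Projectivization.map_mk, Projectivization.mk_eq_mk_iff'] at h
    obtain ⟨a, ha⟩ := h
    rw [Projectivization.mk_eq_mk_iff']
    obtain ⟨j, hj⟩ := Function.ne_iff.mp hv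
    have hj : v j ≠ 0 := hj
    have ha' : ∀ i, a * (v i : AlgebraicClosure k) = u i := fun i => congrFun ha i
    have hj' : (v j : AlgebraicClosure k) ≠ 0 := by simpa using hj
    have haa : a = ((u j / v j : fixK k r) : AlgebraicClosure k) := by
      push_cast
      rw [← ha' j]; field_simp
    refine ⟨u j / v j, ?_⟩
    funext i
    apply Subtype.ext
    simp only [Pi.smul_apply, smul_eq_mul]
    rw [← ha' i, haa]
    rfl
  rw [hrange]
  refine ⟨Set.finite_range _, ?_⟩
  rw [← hcard, Set.ncard_def, ← Set.image_univ, Set.InjOn.encard_image hinj.injOn, Set.encard_univ]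
  rfl
end FixedPoints
section Series
open PowerSeries Finset

/-- geometric series -/
noncomputable def gU (c : ℚ) : PowerSeries ℚ := PowerSeries.mk (fun n => c ^ n)
/-- geometric series in the square of the variable -/
noncomputable def gV (c : ℚ) : PowerSeries ℚ :=
  PowerSeries.mk (fun n => if 2 ∣ n then c ^ (n / 2) else 0)

lemma gU_mul (c : ℚ) : (1 - PowerSeries.C c * X) * gU c = 1 := by
  ext n
  rw [sub_mul, one_mul, mul_assoc]
  cases n with
  | zero => simp [gU]
  | succ n =>
    rw [map_sub, PowerSeries.coeff_C_mul, PowerSeries.coeff_succ_X_mul]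
    simp [gU, PowerSeries.coeff_one, pow_succ']

lemma gV_mul (c : ℚ) : (1 - PowerSeries.C c * X ^ 2) * gV c = 1 := by
  ext n
  rw [sub_mul, one_mul, mul_assoc, map_sub, PowerSeries.coeff_C_mul, PowerSeries.coeff_X_pow_mul']
  rcases n with _ | _ | n
  · simp [gV]
  · simp [gV, PowerSeries.coeff_one]
  · have : 2 ∣ n + 1 + 1 ↔ 2 ∣ n := by omega
    have h2 : (n + 1 + 1) / 2 = n / 2 + 1 := by omega
    simp only [gV, PowerSeries.coeff_mk, PowerSeries.coeff_one, this, h2]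
    by_cases h : 2 ∣ n <;> simp [h, pow_succ']

lemma gfac_deriv (c : ℚ) :
    X * PowerSeries.derivative ℚ ((1 - PowerSeries.C c * X ^ 2) * gU c) =
      ((1 - PowerSeries.C c * X ^ 2) * gU c) * (gU c - 2 * gV c + 1) := by
  have hU := gU_mul c
  have hV := gV_mul c
  have hd : PowerSeries.derivative ℚ (gU c) = PowerSeries.C c * gU c ^ 2 := by
    have h := congrArg (PowerSeries.derivative ℚ) hU
    simp only [Derivation.leibniz, map_sub, smul_eq_mul, Derivation.map_one_eq_zero,
      PowerSeries.derivative_X, PowerSeries.derivative_C] at h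
    linear_combination gU c * h - (PowerSeries.derivative ℚ (gU c)) * hU
  simp only [Derivation.leibniz, Derivation.leibniz_pow, map_sub, smul_eq_mul, Derivation.map_one_eq_zero,
      PowerSeries.derivative_X, PowerSeries.derivative_C, hd]
  simp only [nsmul_eq_mul, Nat.cast_ofNat]
  linear_combination (-(1 - PowerSeries.C c * X ^ 2) * gU c) * hU +
    (2 * gU c) * hV

lemma gprod_deriv {ι : Type*} (s : Finset ι) (f b : ι → PowerSeries ℚ)
    (h : ∀ i ∈ s, X * PowerSeries.derivative ℚ (f i) = f i * b i) :
    X * PowerSeries.derivative ℚ (∏ i ∈ s, f i) = (∏ i ∈ s, f i) * ∑ i ∈ s, b i := by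
  classical
  induction s using Finset.induction_on with
  | empty => simp
  | insert i s hi ih =>
    rw [prod_insert hi, sum_insert hi, Derivation.leibniz]
    have h1 := h i (mem_insert_self _ _)
    have h2 := ih (fun j hj => h j (mem_insert_of_mem hj))
    simp only [smul_eq_mul]
    linear_combination (∏ i ∈ s, f i) * h1 + f i * h2

lemma rec_of_deriv (f B : PowerSeries ℚ) (hB : PowerSeries.coeff 0 B = 0)
    (h : X * PowerSeries.derivative ℚ f = f * B) (n : ℕ) :
    (n : ℚ) * PowerSeries.coeff n f =
      ∑ r ∈ Icc 1 n, PowerSeries.coeff r B * PowerSeries.coeff (n - r) f := by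
  have h' := congrArg (PowerSeries.coeff n) h
  have e1 : PowerSeries.coeff n (X * PowerSeries.derivative ℚ f) = n * PowerSeries.coeff n f := by
    cases n with
    | zero => simp
    | succ n =>
      rw [PowerSeries.coeff_succ_X_mul, PowerSeries.coeff_derivative, mul_comm]
      push_cast; rfl
  rw [e1, mul_comm f B, PowerSeries.coeff_mul,
    Finset.Nat.sum_antidiagonal_eq_sum_range_succ_mk] at h'
  rw [h']
  symm
  apply Finset.sum_subset
  · intro x; simp only [mem_Icc, mem_range]; omega
  · intro x hx hx'
    simp only [mem_Icc, mem_range] at hx hx'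
    have : x = 0 := by omega
    subst this
    simp [hB]

lemma rec_unique (b f g : ℕ → ℚ) (h0 : f 0 = g 0)
    (hf : ∀ n : ℕ, (n : ℚ) * f n = ∑ r ∈ Icc 1 n, b r * f (n - r))
    (hg : ∀ n : ℕ, (n : ℚ) * g n = ∑ r ∈ Icc 1 n, b r * g (n - r)) (n : ℕ) : f n = g n := by
  induction n using Nat.strong_induction_on with
  | _ n ih =>
    rcases Nat.eq_zero_or_pos n with rfl | hn
    · exact h0
    have hn' : (n : ℚ) ≠ 0 := by positivity
    apply mul_left_cancel₀ hn'
    rw [hf, hg]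
    apply Finset.sum_congr rfl
    intro r hr
    rw [mem_Icc] at hr
    rw [ih (n - r) (by omega)]

/-- the rational generating function -/
noncomputable def gR (M : ℕ) (x : ℕ → ℚ) : PowerSeries ℚ :=
  ∏ i ∈ range M, ((1 - PowerSeries.C (x i) * X ^ 2) * gU (x i))

lemma eq_gR (M : ℕ) (x : ℕ → ℚ) (a : ℕ → ℚ) (h0 : a 0 = 1)
    (ha : ∀ n : ℕ, (n : ℚ) * a n = ∑ r ∈ Icc 1 n,
      ((∑ i ∈ range M, x i ^ r) - 2 * (if 2 ∣ r then ∑ i ∈ range M, x i ^ (r / 2) else 0))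
        * a (n - r)) (n : ℕ) : a n = PowerSeries.coeff n (gR M x) := by
  have hd := gprod_deriv (range M) (fun i => (1 - PowerSeries.C (x i) * X ^ 2) * gU (x i))
    (fun i => gU (x i) - 2 * gV (x i) + 1) (fun i _ => gfac_deriv (x i))
  have hc : ∀ r, PowerSeries.coeff r (∑ i ∈ range M, (gU (x i) - 2 * gV (x i) + 1)) =
      ((∑ i ∈ range M, x i ^ r) - 2 * (if 2 ∣ r then ∑ i ∈ range M, x i ^ (r / 2) else 0)) +
        if r = 0 then (M : ℚ) else 0 := by
    intro r
    have h2 : (2 : PowerSeries ℚ) = PowerSeries.C 2 := (map_ofNat PowerSeries.C 2).symm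
    simp only [map_sum, map_add, map_sub, h2, PowerSeries.coeff_C_mul, gU, gV,
      PowerSeries.coeff_mk, PowerSeries.coeff_one, sum_add_distrib, sum_sub_distrib, ← mul_sum]
    congr 1
    · split_ifs <;> simp
    · split_ifs <;> simp
  refine rec_unique _ a (fun n => PowerSeries.coeff n (gR M x)) ?_ ha ?_ n
  · simp [h0, gR, gU, map_prod]
  · intro n
    have := rec_of_deriv (gR M x) _ (by rw [hc 0]; simp; ring) hd n
    rw [this]
    apply Finset.sum_congr rfl
    intro r hr
    rw [mem_Icc] at hr
    have hr0 : r ≠ 0 := by omega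
    rw [hc r, if_neg hr0, add_zero]

/-- partial fraction coefficient -/
noncomputable def pfc (M : ℕ) (x : ℕ → ℚ) (i : ℕ) : ℚ :=
  (∏ j ∈ range M, (1 - x j * (x i)⁻¹ ^ 2)) / ∏ j ∈ (range M).erase i, (1 - x j * (x i)⁻¹)

open Polynomial in
lemma partial_fractions (M : ℕ) (x : ℕ → ℚ) (hx0 : ∀ i, x i ≠ 0) (hx : Function.Injective x) :
    ∃ E : Polynomial ℚ, E.natDegree ≤ M ∧
      ∏ j ∈ range M, (1 - Polynomial.C (x j) * Polynomial.X ^ 2) =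
        (∏ j ∈ range M, (1 - Polynomial.C (x j) * Polynomial.X)) * E +
        ∑ i ∈ range M, Polynomial.C (pfc M x i) *
          ∏ j ∈ (range M).erase i, (1 - Polynomial.C (x j) * Polynomial.X) := by
  set D : Polynomial ℚ := ∏ j ∈ range M, (1 - Polynomial.C (x j) * Polynomial.X ^ 2) -
    ∑ i ∈ range M, Polynomial.C (pfc M x i) *
          ∏ j ∈ (range M).erase i, (1 - Polynomial.C (x j) * Polynomial.X) with hD
  have hlin : ∀ j, (1 - Polynomial.C (x j) * Polynomial.X : Polynomial ℚ).natDegree = 1 := by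
    intro j
    have : (1 - Polynomial.C (x j) * Polynomial.X : Polynomial ℚ) =
      Polynomial.C (-x j) * Polynomial.X + Polynomial.C 1 := by
      simp; ring
    rw [this, Polynomial.natDegree_linear (by simpa using hx0 j)]
  have hne : ∀ j, (1 - Polynomial.C (x j) * Polynomial.X : Polynomial ℚ) ≠ 0 := by
    intro j h
    have := hlin j
    rw [h] at this
    simp at this
  have hdvd : (∏ j ∈ range M, (1 - Polynomial.C (x j) * Polynomial.X)) ∣ D := by
    apply Finset.prod_dvd_of_coprime
    · intro i _ j _ hij
      have h : x j - x i ≠ 0 := sub_ne_zero.2 (fun h => hij (hx h).symm)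
      refine ⟨Polynomial.C (x j / (x j - x i)), Polynomial.C (-x i / (x j - x i)), ?_⟩
      have e : Polynomial.C (x j / (x j - x i)) + Polynomial.C (-x i / (x j - x i)) = 1 := by
        rw [← Polynomial.C_add, ← Polynomial.C_1]; congr 1; field_simp; ring
      have e2 : Polynomial.C (x j / (x j - x i)) * Polynomial.C (x i) +
          Polynomial.C (-x i / (x j - x i)) * Polynomial.C (x j) = 0 := by
        rw [← Polynomial.C_mul, ← Polynomial.C_mul, ← Polynomial.C_add, ← Polynomial.C_0]
        congr 1; field_simp; ring
      show Polynomial.C (x j / (x j - x i)) * (1 - Polynomial.C (x i) * Polynomial.X) +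
        Polynomial.C (-x i / (x j - x i)) * (1 - Polynomial.C (x j) * Polynomial.X) = 1
      linear_combination e - Polynomial.X * e2
    · intro i hi
      have hroot : D.IsRoot (x i)⁻¹ := by
        rw [Polynomial.IsRoot, hD, Polynomial.eval_sub, Polynomial.eval_prod,
          Polynomial.eval_finsetSum, Finset.sum_eq_single i]
        · simp only [Polynomial.eval_mul, Polynomial.eval_C, Polynomial.eval_prod,
            Polynomial.eval_sub, Polynomial.eval_one, Polynomial.eval_X, Polynomial.eval_pow, pfc]
          rw [div_mul_cancel₀, sub_self]
          rw [Finset.prod_ne_zero_iff]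
          intro j hj h
          have hij : j ≠ i := (mem_erase.1 hj).1
          apply hij
          apply hx
          have := hx0 i
          field_simp at h
          linarith
        · intro j _ hji
          rw [Polynomial.eval_mul, Polynomial.eval_prod]
          apply mul_eq_zero_of_right
          apply Finset.prod_eq_zero (mem_erase.2 ⟨hji.symm, hi⟩)
          simp [hx0 i]
        · exact fun h => absurd hi h
      have h1 := Polynomial.dvd_iff_isRoot.2 hroot
      obtain ⟨G, hG⟩ := h1
      refine ⟨Polynomial.C (-(x i)⁻¹) * G, ?_⟩
      rw [hG]
      have e : Polynomial.C (x i) * Polynomial.C (x i)⁻¹ = (1 : Polynomial ℚ) := by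
        rw [← Polynomial.C_mul, mul_inv_cancel₀ (hx0 i), Polynomial.C_1]
      rw [Polynomial.C_neg]
      linear_combination (- Polynomial.X * G) * e
  obtain ⟨E, hE⟩ := hdvd
  refine ⟨E, ?_, ?_⟩
  · have hdD : D.natDegree ≤ 2 * M := by
      rw [hD]
      apply (Polynomial.natDegree_sub_le _ _).trans
      apply max_le
      · apply (Polynomial.natDegree_prod_le _ _).trans
        apply (Finset.sum_le_card_nsmul _ _ 2 _).trans
        · simp [mul_comm]
        · intro j _
          compute_degree
      · apply Polynomial.natDegree_sum_le_of_forall_le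
        intro i _
        apply (Polynomial.natDegree_C_mul_le _ _).trans
        apply (Polynomial.natDegree_prod_le _ _).trans
        apply (Finset.sum_le_card_nsmul _ _ 1 (fun j _ => (hlin j).le)).trans
        have := Finset.card_erase_le (s := range M) (a := i)
        rw [card_range] at this
        simp only [smul_eq_mul, mul_one]
        omega
    by_cases hE0 : E = 0
    · simp [hE0]
    · rw [hE, Polynomial.natDegree_mul (Finset.prod_ne_zero_iff.2 fun j _ => hne j) hE0,
        Polynomial.natDegree_prod _ _ (fun j _ => hne j)] at hdD
      simp only [hlin, sum_const, card_range, smul_eq_mul, mul_one] at hdD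
      omega
  · rw [← hE, hD]; ring

lemma coeff_gR (M : ℕ) (x : ℕ → ℚ) (hx0 : ∀ i, x i ≠ 0) (hx : Function.Injective x)
    (n : ℕ) (hn : M < n) :
    PowerSeries.coeff n (gR M x) = ∑ i ∈ range M, pfc M x i * x i ^ n := by
  obtain ⟨E, hE, h⟩ := partial_fractions M x hx0 hx
  have h' := congrArg (Polynomial.coeToPowerSeries.ringHom (R := ℚ)) h
  simp only [map_add, map_mul, map_prod, map_sum, map_sub, map_one, map_pow,
    Polynomial.coeToPowerSeries.ringHom_apply, Polynomial.coe_C, Polynomial.coe_X] at h'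
  have hU : (∏ j ∈ range M, (1 - PowerSeries.C (x j) * X)) * ∏ j ∈ range M, gU (x j) = 1 := by
    rw [← prod_mul_distrib]
    exact Finset.prod_eq_one (fun j _ => gU_mul _)
  have hUi : ∀ i ∈ range M, (∏ j ∈ (range M).erase i, (1 - PowerSeries.C (x j) * X)) *
      ∏ j ∈ range M, gU (x j) = gU (x i) := by
    intro i hi
    rw [← Finset.mul_prod_erase _ _ hi, mul_left_comm, ← prod_mul_distrib,
      Finset.prod_eq_one (fun j _ => gU_mul _), mul_one]
  have hR : gR M x = (E : PowerSeries ℚ) + ∑ i ∈ range M, PowerSeries.C (pfc M x i) * gU (x i) := by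
    rw [gR, prod_mul_distrib, h', add_mul, sum_mul, mul_right_comm, hU, one_mul]
    congr 1
    apply Finset.sum_congr rfl
    intro i hi
    rw [mul_assoc, hUi i hi]
  rw [hR, map_add, Polynomial.coeff_coe, Polynomial.coeff_eq_zero_of_natDegree_lt (by omega), zero_add,
    map_sum]
  apply Finset.sum_congr rfl
  intro i _
  rw [PowerSeries.coeff_C_mul, gU, PowerSeries.coeff_mk]
end Series

section Final
open Finset

lemma Lam_ne_zero (q r : ℕ) (hq : 2 ≤ q) : Lam q r ≠ 0 := by
  unfold Lam
  rw [Finset.prod_ne_zero_iff]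
  intro i _ h
  have h1 : ((q : ℚ)⁻¹) ^ (i + 1) < 1 := by
    apply pow_lt_one₀ (by positivity) _ (by omega)
    apply inv_lt_one_of_one_lt₀
    exact_mod_cast hq
  linarith

lemma prod_up (q M : ℕ) (hq : 2 ≤ q) : ∏ t ∈ range M, (1 - (q : ℚ) ^ (t + 1)) =
    (-1) ^ M * (q : ℚ) ^ (M * (M + 1) / 2) * Lam q M := by
  have hq0 : (q : ℚ) ≠ 0 := by positivity
  induction M with
  | zero => simp [Lam]
  | succ M ih =>
    have e : (M + 1) * (M + 1 + 1) / 2 = M * (M + 1) / 2 + (M + 1) := by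
      rw [show (M + 1) * (M + 1 + 1) = M * (M + 1) + (M + 1) * 2 by ring]
      exact Nat.add_mul_div_right _ _ (by norm_num)
    have hl : Lam q (M + 1) = Lam q M * (1 - (q : ℚ)⁻¹ ^ (M + 1)) := by
      unfold Lam; rw [prod_range_succ]
    have e2 : (q : ℚ) ^ (M + 1) * (q : ℚ)⁻¹ ^ (M + 1) = 1 := by
      rw [← mul_pow, mul_inv_cancel₀ hq0, one_pow]
    rw [prod_range_succ, ih, e, hl, pow_add _ _ (M + 1), pow_succ (-1 : ℚ)]
    linear_combination (-((-1) ^ M * (q : ℚ) ^ (M * (M + 1) / 2) * Lam q M)) * e2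

lemma pfc_zero (q N i : ℕ) (hq : 2 ≤ q) (hi : 2 * i ≤ N) :
    pfc (N + 1) (fun j => (q : ℚ) ^ j) i = 0 := by
  have hq0 : (q : ℚ) ≠ 0 := by positivity
  unfold pfc
  rw [div_eq_zero_iff]
  left
  apply Finset.prod_eq_zero (i := 2 * i) (mem_range.2 (by omega))
  rw [← inv_pow, ← pow_mul, mul_comm i 2, inv_pow, mul_inv_cancel₀ (pow_ne_zero _ hq0), sub_self]

lemma pow_div_aux (q a b : ℕ) (hq : 2 ≤ q) (h : a ≤ b) :
    (q : ℚ) ^ a * ((q : ℚ)⁻¹) ^ b = ((q : ℚ)⁻¹) ^ (b - a) := by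
  have hq0 : (q : ℚ) ≠ 0 := by positivity
  obtain ⟨c, rfl⟩ := Nat.exists_eq_add_of_le h
  rw [pow_add, ← mul_assoc, ← mul_pow, mul_inv_cancel₀ hq0, one_pow, one_mul, Nat.add_sub_cancel_left]

lemma pfc_eq (q N i : ℕ) (hq : 2 ≤ q) (hi : N < 2 * i) (hiN : i ≤ N) :
    pfc (N + 1) (fun j => (q : ℚ) ^ j) i =
      (-1 : ℚ) ^ (N - i) * Lam q (2 * i) /
            (Lam q (2 * i - (N + 1)) * Lam q i * Lam q (N - i)) /
        (q : ℚ) ^ ((N - i) * (N - i + 1) / 2) := by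
  have hq0 : (q : ℚ) ≠ 0 := by positivity
  have hnum : ∏ j ∈ range (N + 1), (1 - (q : ℚ) ^ j * ((q : ℚ) ^ i)⁻¹ ^ 2) =
      Lam q (2 * i) / Lam q (2 * i - (N + 1)) := by
    rw [eq_div_iff (Lam_ne_zero _ _ hq)]
    obtain ⟨m, hm⟩ : ∃ m, 2 * i = m + (N + 1) := ⟨2 * i - (N + 1), by omega⟩
    rw [hm, Nat.add_sub_cancel]
    unfold Lam
    rw [prod_range_add _ m (N + 1), mul_comm]
    congr 1
    rw [← Finset.prod_range_reflect]
    apply Finset.prod_congr rfl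
    intro j hj
    rw [mem_range] at hj
    rw [← inv_pow, ← pow_mul, mul_comm i 2, hm, pow_div_aux q _ _ hq (by omega)]
    congr 2
    omega
  have hden : ∏ j ∈ (range (N + 1)).erase i, (1 - (q : ℚ) ^ j * ((q : ℚ) ^ i)⁻¹) =
      Lam q i * ((-1) ^ (N - i) * (q : ℚ) ^ ((N - i) * (N - i + 1) / 2) * Lam q (N - i)) := by
    rw [← prod_up q (N - i) hq]
    have hs : (range (N + 1)).erase i = range i ∪ (range (N - i)).image (fun t => i + 1 + t) := by
      ext j
      simp only [mem_erase, mem_range, mem_union, mem_image]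
      constructor
      · rintro ⟨h1, h2⟩
        rcases lt_or_gt_of_ne h1 with h | h
        · exact Or.inl h
        · exact Or.inr ⟨j - (i + 1), by omega, by omega⟩
      · rintro (h | ⟨t, h, rfl⟩) <;> omega
    rw [hs, prod_union, prod_image (by intro a _ b _ h; simpa using h)]
    · congr 1
      · unfold Lam
        rw [← Finset.prod_range_reflect]
        apply Finset.prod_congr rfl
        intro j hj
        rw [mem_range] at hj
        rw [← inv_pow, pow_div_aux q _ _ hq (by omega)]
        congr 2
        omega
      · apply Finset.prod_congr rfl
        intro t _
        congr 1
        rw [show i + 1 + t = (t + 1) + i by ring, pow_add, mul_assoc,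
          mul_inv_cancel₀ (pow_ne_zero _ hq0), mul_one]
    · rw [Finset.disjoint_left]
      intro j hj
      simp only [mem_range, mem_image, not_exists] at hj ⊢
      rintro t ⟨_, rfl⟩
      omega
  have hs : ((-1 : ℚ) ^ (N - i)) * (-1) ^ (N - i) = 1 := by
    rw [← mul_pow]; simp
  unfold pfc
  rw [hnum, hden]
  have h1 := Lam_ne_zero q (2 * i - (N + 1)) hq
  have h2 := Lam_ne_zero q i hq
  have h3 := Lam_ne_zero q (N - i) hq
  have h4 : (-1 : ℚ) ^ (N - i) ≠ 0 := by positivity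
  have h5 : (q : ℚ) ^ ((N - i) * (N - i + 1) / 2) ≠ 0 := pow_ne_zero _ hq0
  generalize (q : ℚ) ^ ((N - i) * (N - i + 1) / 2) = w at *
  generalize (-1 : ℚ) ^ (N - i) = s at *
  rw [div_div, div_div, div_eq_div_iff (by positivity) (by positivity)]
  linear_combination (-Lam q (2 * i) * Lam q (2 * i - (N + 1)) * Lam q i * Lam q (N - i) * w) * hs

end Final

/-- For every `n > N + 1`, the number `a(n)` of `n`-element subsets
`S ⊆ ℙ^N(k̄)` with `σ(S) = S` equals
`∑_{N/2 < i ≤ N} ((−1)^{N−i} Λ(2i) / (Λ(2i−N−1) Λ(i) Λ(N−i))) ·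
q^{in − (N−i)(N−i+1)/2}`. -/
theorem stmt7 (k : Type*) [Field k] [Fintype k] (q N n : ℕ)
    (hq : Fintype.card k = q) (hn : N + 1 < n) :
    (nSetCount (projFrob k (N + 1)) Set.univ n : ℚ) =
      ∑ i ∈ Finset.Ioc (N / 2) N,
        ((-1 : ℚ) ^ (N - i) * Lam q (2 * i) /
            (Lam q (2 * i - (N + 1)) * Lam q i * Lam q (N - i))) *
          ((q : ℚ) ^ (i * n) / (q : ℚ) ^ ((N - i) * (N - i + 1) / 2)) := by
  have hq2 : 2 ≤ q := by rw [← hq]; exact Fintype.one_lt_card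
  have hq0 : (q : ℚ) ≠ 0 := by positivity
  have hinj : Function.Injective (fun j : ℕ => (q : ℚ) ^ j) :=
    pow_right_injective₀ (by positivity) (by
      have : (1 : ℚ) < q := by exact_mod_cast hq2
      exact this.ne')
  have hF : ∀ r, r ≠ 0 → (({P | (projFrob k (N + 1))^[r] P = P}.ncard : ℕ) : ℚ) =
      ∑ i ∈ Finset.range (N + 1), ((q : ℚ) ^ i) ^ r := by
    intro r hr
    rw [(fix_card k r (N + 1) hr).2, hq]
    push_cast
    apply Finset.sum_congr rfl
    intro i _
    rw [← pow_mul, ← pow_mul, mul_comm]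
  have hA := eq_gR (N + 1) (fun j => (q : ℚ) ^ j)
    (fun n => (nSetCount (projFrob k (N + 1)) Set.univ n : ℚ)) (by simp [count_zero]) (by
      intro n
      have := count_rec (projFrob k (N + 1)) (fun r hr => (fix_card k r (N + 1) hr).1) n
      refine this.trans ?_
      apply Finset.sum_congr rfl
      intro r hr
      rw [Finset.mem_Icc] at hr
      congr 1
      rw [hF r (by omega)]
      congr 2
      split_ifs with h
      · exact hF (r / 2) (by omega)
      · rfl) n
  have hA' : (nSetCount (projFrob k (N + 1)) Set.univ n : ℚ) = _ := hA
  rw [hA', coeff_gR (N + 1) _ (fun i => pow_ne_zero _ hq0) hinj n hn]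
  symm
  refine (Finset.sum_congr rfl ?_).trans (Finset.sum_subset
    (f := fun i => pfc (N + 1) (fun j => (q : ℚ) ^ j) i * ((q : ℚ) ^ i) ^ n) ?_ ?_)
  · intro i hi
    rw [Finset.mem_Ioc] at hi
    rw [pfc_eq q N i hq2 (by omega) hi.2, ← pow_mul]
    ring
  · intro i hi
    rw [Finset.mem_Ioc] at hi
    rw [Finset.mem_range]
    omega
  · intro i hi hi'
    rw [Finset.mem_Ioc] at hi'
    rw [Finset.mem_range] at hi
    rw [pfc_zero q N i hq2 (by omega), zero_mul]
end

section
/- Let Q ∈ ℙ²(k̄) be a point of degree 3, i.e. its σ-orbit {Q, σ(Q), σ²(Q)} has exactly 3 elements, and set X = ℙ²(k̄) \ {Q, σ(Q), σ²(Q)}. Let a(n) be the number of n-element subsets S ⊆ X with σ(S) = S. Then for n > 0: a(n) = ((q² + q + 1)/(q⁴ − q² + 1)) · ((q² − 1) q^{2n} + (−1)^{(n−1)/3}) if n ≡ 1 (mod 3); a(n) = ((q² + q + 1)/(q⁴ − q² + 1)) · ((q² − 1) q^{2n} + (−1)^{(n−2)/3} q²) if n ≡ 2 (mod 3); and a(n)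 = ((q³ − 1)(q + 1)/(q⁴ − q² + 1)) · (q^{2n} − (−1)^{n/3}) if n ≡ 0 (mod 3). -/
namespace St9
open Function PowerSeries

/-- stable sets -/
def E {X : Type*} (σ : X → X) (A : Set X) (n : ℕ) : Set (Set X) :=
  {S : Set X | S ⊆ A ∧ S.Finite ∧ S.ncard = n ∧ σ '' S = S}

/-- orbit -/
def orb {X : Type*} (σ : X → X) (x : X) : Set X := (fun i => σ^[i] x) '' Set.Iio (minimalPeriod σ x)

lemma orb_finite {X : Type*} (σ : X → X) (x : X) : (orb σ x).Finite :=
  (Set.finite_Iio _).image _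

lemma orb_ncard {X : Type*} (σ : X → X) (x : X) : (orb σ x).ncard = minimalPeriod σ x := by
  unfold orb
  rw [Set.InjOn.ncard_image iterate_injOn_Iio_minimalPeriod]
  simp [Set.ncard_eq_toFinset_card']

lemma mem_orb {X : Type*} (σ : X → X) (x : X) (h : 0 < minimalPeriod σ x) (i : ℕ) :
    σ^[i] x ∈ orb σ x :=
  ⟨i % minimalPeriod σ x, Nat.mod_lt _ h, iterate_mod_minimalPeriod_eq⟩

lemma orb_image {X : Type*} (σ : X → X) (x : X) (h : 0 < minimalPeriod σ x) :
    σ '' orb σ x = orb σ x := by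
  apply Set.Subset.antisymm
  · rintro _ ⟨_, ⟨i, hi, rfl⟩, rfl⟩
    have := mem_orb σ x h (i+1)
    rwa [iterate_succ_apply'] at this
  · rintro _ ⟨i, hi, rfl⟩
    refine ⟨σ^[i + (minimalPeriod σ x - 1)] x, mem_orb σ x h _, ?_⟩
    rw [← iterate_succ_apply' σ, show (i + (minimalPeriod σ x - 1)).succ = i + minimalPeriod σ x by omega]
    simp [iterate_add_apply]

lemma iter_mem {X : Type*} {σ : X → X} {S : Set X} (h : ∀ y ∈ S, σ y ∈ S) {x : X} (hx : x ∈ S) (i : ℕ) :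
    σ^[i] x ∈ S := by
  induction i with
  | zero => exact hx
  | succ i ih => rw [iterate_succ_apply']; exact h _ ih

lemma orb_sub {X : Type*} {σ : X → X} {S : Set X} (h : ∀ y ∈ S, σ y ∈ S) {x : X} (hx : x ∈ S) :
    orb σ x ⊆ S := by
  rintro _ ⟨i, _, rfl⟩; exact iter_mem h hx i

lemma E_stable {X : Type*} {σ : X → X} {S : Set X} (h : σ '' S = S) : ∀ y ∈ S, σ y ∈ S :=
  fun y hy => h ▸ Set.mem_image_of_mem σ hy

lemma period_of_mem {X : Type*} {σ : X → X} (hσ : Injective σ) {S : Set X} (hf : S.Finite)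
    (h : σ '' S = S) {x : X} (hx : x ∈ S) :
    0 < minimalPeriod σ x ∧ minimalPeriod σ x ≤ S.ncard := by
  have h1 : 0 < minimalPeriod σ x := by
    rw [minimalPeriod_pos_iff_mem_periodicPts]
    have hm : Set.MapsTo (fun i => σ^[i] x) Set.univ S := fun i _ => iter_mem (E_stable h) hx i
    obtain ⟨i, -, j, -, hij, he⟩ := Set.infinite_univ.exists_ne_map_eq_of_mapsTo hm hf
    wlog hlt : i < j generalizing i j
    · exact this j i hij.symm he.symm (by omega)
    refine ⟨j - i, by omega, ?_⟩
    apply hσ.iterate i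
    rw [← iterate_add_apply, show i + (j - i) = j by omega]
    exact he.symm
  refine ⟨h1, ?_⟩
  rw [← orb_ncard]
  exact Set.ncard_le_ncard (orb_sub (E_stable h) hx) hf

/-- count through x -/
noncomputable def ex {X : Type*} (σ : X → X) (A : Set X) (x : X) (n : ℕ) : ℕ :=
  Set.ncard {S | S ∈ E σ A n ∧ x ∈ S}

lemma ex_lt {X : Type*} {σ : X → X} (hσ : Injective σ) (A : Set X) (x : X) (n : ℕ)
    (h : n < minimalPeriod σ x) : ex σ A x n = 0 := by
  unfold ex
  convert Set.ncard_empty (Set X)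
  rw [Set.eq_empty_iff_forall_notMem]
  rintro S ⟨⟨_, hf, hc, hs⟩, hx⟩
  have := (period_of_mem hσ hf hs hx).2
  omega

lemma ex_add {X : Type*} {σ : X → X} (hσ : Injective σ) (A : Set X) (hA : ∀ y ∈ A, σ y ∈ A)
    (x : X) (hx : x ∈ A) (hd : 0 < minimalPeriod σ x)
    (n : ℕ) (hE : (E σ A n).Finite) :
    ex σ A x (n + minimalPeriod σ x) + ex σ A x n = nSetCount σ A n := by
  have hxo : x ∈ orb σ x := mem_orb σ x hd 0
  have h1 : ex σ A x (n + minimalPeriod σ x) = Set.ncard {S | S ∈ E σ A n ∧ x ∉ S} := by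
    unfold ex
    refine Set.ncard_congr (fun S _ => S \ orb σ x) ?_ ?_ ?_
    · rintro S ⟨⟨h1, h2, h3, h4⟩, h5⟩
      refine ⟨⟨Set.sdiff_subset.trans h1, h2.subset Set.sdiff_subset, ?_, ?_⟩, fun h => h.2 hxo⟩
      · rw [Set.ncard_sdiff (orb_sub (E_stable h4) h5) (orb_finite _ _), orb_ncard, h3]; omega
      · rw [Set.image_sdiff hσ, h4, orb_image _ _ hd]
    · rintro S T ⟨⟨h1, h2, h3, h4⟩, h5⟩ ⟨⟨h1', h2', h3', h4'⟩, h5'⟩ h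
      have a1 := orb_sub (E_stable h4) h5
      have a2 := orb_sub (E_stable h4') h5'
      rw [← Set.sdiff_union_of_subset a1, ← Set.sdiff_union_of_subset a2]
      exact congrArg (· ∪ orb σ x) h
    · rintro S ⟨⟨h1, h2, h3, h4⟩, h5⟩
      have hdis : Disjoint S (orb σ x) := by
        rw [Set.disjoint_left]
        rintro _ hy ⟨i, hi, rfl⟩
        apply h5
        have := iter_mem (E_stable h4) hy (minimalPeriod σ x - i)
        simp only at this
        rw [← iterate_add_apply, Nat.sub_add_cancel (le_of_lt hi), iterate_minimalPeriod] at this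
        exact this
      refine ⟨S ∪ orb σ x, ⟨⟨Set.union_subset h1 (orb_sub hA hx), h2.union (orb_finite _ _), ?_, ?_⟩, Or.inr hxo⟩, ?_⟩
      · rw [Set.ncard_union_eq hdis h2 (orb_finite _ _), orb_ncard, h3]
      · rw [Set.image_union, h4, orb_image _ _ hd]
      · simp [hdis.sdiff_eq_left]
  have h2 : nSetCount σ A n = (E σ A n).ncard := rfl
  rw [h1, h2, add_comm]
  unfold ex
  rw [← Set.ncard_union_eq ?_ (hE.subset fun S h => h.1) (hE.subset fun S h => h.1)]
  · congr 1; ext S; simp only [Set.mem_union, Set.mem_ofPred_eq]; tauto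
  · rw [Set.disjoint_left]; rintro S ⟨_, a⟩ ⟨_, b⟩; exact b a

/-- points of period at most n -/
def T {X : Type*} (σ : X → X) (A : Set X) (n : ℕ) : Set X :=
  {x | x ∈ A ∧ 0 < minimalPeriod σ x ∧ minimalPeriod σ x ≤ n}

lemma T_finite {X : Type*} {σ : X → X} (A : Set X)
    (hfin : ∀ m, 0 < m → {x | x ∈ A ∧ IsPeriodicPt σ m x}.Finite) (n : ℕ) : (T σ A n).Finite := by
  refine Set.Finite.subset (Set.Finite.biUnion (Set.finite_Icc 1 n) 
    (t := fun m => {x | x ∈ A ∧ IsPeriodicPt σ m x}) (fun m hm => hfin m hm.1)) ?_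
  rintro x ⟨h1, h2, h3⟩
  simp only [Set.mem_iUnion]
  exact ⟨_, ⟨h2, h3⟩, h1, isPeriodicPt_minimalPeriod _ _⟩

lemma E_finite {X : Type*} {σ : X → X} (hσ : Injective σ) (A : Set X)
    (hfin : ∀ m, 0 < m → {x | x ∈ A ∧ IsPeriodicPt σ m x}.Finite) (n : ℕ) : (E σ A n).Finite := by
  refine (T_finite A hfin n).finite_subsets.subset ?_
  rintro S ⟨h1, h2, h3, h4⟩ x hx
  have := period_of_mem hσ h2 h4 hx
  exact ⟨h1 hx, this.1, h3 ▸ this.2⟩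

lemma double_count {X : Type*} {σ : X → X} (hσ : Injective σ) (A : Set X)
    (hfin : ∀ m, 0 < m → {x | x ∈ A ∧ IsPeriodicPt σ m x}.Finite) (n : ℕ) :
    n * nSetCount σ A n = ∑ x ∈ (T_finite A hfin n).toFinset, ex σ A x n := by
  classical
  have hE := E_finite hσ A hfin n
  have := Finset.sum_card_bipartiteAbove_eq_sum_card_bipartiteBelow
    (s := (T_finite A hfin n).toFinset) (t := hE.toFinset) (fun x S => x ∈ S)
  have h2 : ∑ x ∈ (T_finite A hfin n).toFinset, ex σ A x n =
      ∑ x ∈ (T_finite A hfin n).toFinset, 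
        (Finset.bipartiteAbove (fun (x : X) (S : Set X) => x ∈ S) hE.toFinset x).card := by
    refine Finset.sum_congr rfl fun x _ => ?_
    unfold ex
    rw [← Set.ncard_coe_finset]
    congr 1
    ext S; simp [Finset.bipartiteAbove]
  rw [h2, this]
  have h3 : nSetCount σ A n = hE.toFinset.card := by
    rw [← Set.ncard_coe_finset, Set.Finite.coe_toFinset]; rfl
  rw [h3, mul_comm, ← smul_eq_mul, ← Finset.sum_const]
  refine Finset.sum_congr rfl fun S hS => ?_
  rw [Set.Finite.mem_toFinset] at hS
  obtain ⟨h1, h2, h3, h4⟩ := hS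
  rw [← Set.ncard_coe_finset, ← h3]
  congr 1
  ext x; simp only [Finset.bipartiteBelow, Finset.coe_filter, Set.Finite.mem_toFinset, Set.mem_ofPred_eq]
  refine ⟨fun hx => ⟨⟨h1 hx, ?_⟩, hx⟩, fun h => h.2⟩
  have := period_of_mem hσ h2 h4 hx
  exact ⟨this.1, h3 ▸ this.2⟩

/-- sign coefficients -/
noncomputable def s (d m : ℕ) : ℚ :=
  if m = 0 then 0 else (if d ∣ m then 1 else 0) - 2 * (if 2 * d ∣ m then 1 else 0)

lemma s_add (d m : ℕ) (hd : 0 < d) (hm : 0 < m) : s d (m + d) = - s d m := by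
  unfold s
  rw [if_neg (show m + d ≠ 0 by omega), if_neg hm.ne']
  by_cases h : d ∣ m
  · obtain ⟨j, rfl⟩ := h
    have e1 : (2 * d ∣ d * j + d) ↔ ¬ 2 ∣ j := by
      rw [show d * j + d = (j + 1) * d by ring, Nat.mul_dvd_mul_iff_right hd]; omega
    have e2 : (2 * d ∣ d * j) ↔ 2 ∣ j := by
      rw [mul_comm d j, Nat.mul_dvd_mul_iff_right hd]
    simp only [e1, e2]
    by_cases h2 : 2 ∣ j <;> simp [h2] <;> try norm_num
  · have e1 : ¬ (2 * d ∣ m + d) := fun h' => h ((Nat.dvd_add_left dvd_rfl).1 ((Dvd.intro_left 2 rfl).trans h'))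
    have e2 : ¬ (2 * d ∣ m) := fun h' => h ((Dvd.intro_left 2 rfl).trans h')
    simp [h, e1, e2]

lemma s_lt (d m : ℕ) (hm : m < d) : s d m = 0 := by
  unfold s
  split_ifs with h1 h2 h3 h4
  · rfl
  · exact absurd (Nat.le_of_dvd (by omega) h2) (by omega)
  · exact absurd (Nat.le_of_dvd (by omega) h2) (by omega)
  · exact absurd (Nat.le_of_dvd (by omega) h4) (by omega)
  · simp

lemma s_self (d : ℕ) (hd : 0 < d) : s d d = 1 := by
  unfold s
  have : ¬ (2 * d ∣ d) := fun h => absurd (Nat.le_of_dvd hd h) (by omega)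
  simp [this]; omega

lemma S_mul (d : ℕ) (hd : 0 < d) : (mk (s d)) * (1 + X ^ d : ℚ⟦X⟧) = X ^ d := by
  ext m
  rw [mul_add, mul_one, map_add, coeff_mul_X_pow', coeff_X_pow, coeff_mk]
  split_ifs with h1 h2 h2
  · subst h2; rw [s_self m hd]; simp [s]
  · rw [coeff_mk]
    obtain ⟨r, rfl⟩ := Nat.exists_eq_add_of_le' h1
    rw [s_add _ _ hd (by omega)]; simp
  · omega
  · rw [s_lt _ _ (by omega)]; simp

lemma EX_eq {X : Type*} {σ : X → X} (hσ : Injective σ) (A : Set X) (hA : ∀ y ∈ A, σ y ∈ A)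
    (hfin : ∀ m, 0 < m → {x | x ∈ A ∧ IsPeriodicPt σ m x}.Finite)
    (x : X) (hx : x ∈ A) (hd : 0 < minimalPeriod σ x) :
    (mk fun n => (ex σ A x n : ℚ)) = mk (s (minimalPeriod σ x)) * mk fun n => (nSetCount σ A n : ℚ) := by
  set d := minimalPeriod σ x with hdd
  have hne : (1 + PowerSeries.X ^ d : ℚ⟦X⟧) ≠ 0 := by
    intro h
    have := congrArg (coeff 0) h
    simp [hd.ne'] at this
  apply mul_right_cancel₀ hne
  rw [mul_right_comm, S_mul d hd]
  ext m
  rw [mul_add, mul_one, map_add, coeff_mul_X_pow', mul_comm (PowerSeries.X ^ d), coeff_mul_X_pow', coeff_mk]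
  split_ifs with h1
  · obtain ⟨r, rfl⟩ := Nat.exists_eq_add_of_le' h1
    simp only [coeff_mk, Nat.add_sub_cancel]
    exact_mod_cast ex_add hσ A hA x hx hd r (E_finite hσ A hfin r)
  · rw [ex_lt hσ A x m (by omega)]; simp

theorem main_rec {X : Type*} {σ : X → X} (hσ : Injective σ) (A : Set X) (hA : ∀ y ∈ A, σ y ∈ A)
    (hfin : ∀ m, 0 < m → {x | x ∈ A ∧ IsPeriodicPt σ m x}.Finite)
    (c : ℕ → ℚ) (hc0 : c 0 = 0)
    (hc : ∀ m, 0 < m → c m = ({x | x ∈ A ∧ IsPeriodicPt σ m x}.ncard : ℚ) -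
      2 * (if 2 ∣ m then ({x | x ∈ A ∧ IsPeriodicPt σ (m/2) x}.ncard : ℚ) else 0)) :
    PowerSeries.X * PowerSeries.derivative ℚ (mk fun n => (nSetCount σ A n : ℚ)) =
      mk c * mk fun n => (nSetCount σ A n : ℚ) := by
  classical
  ext n
  have key : (n : ℚ) * nSetCount σ A n = 
      coeff n (mk c * mk fun n => (nSetCount σ A n : ℚ)) := by
    have h := congrArg (Nat.cast (R := ℚ)) (double_count hσ A hfin n)
    push_cast at h
    rw [h]
    have h1 : ∀ x ∈ (T_finite A hfin n).toFinset, (ex σ A x n : ℚ) = 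
        ∑ p ∈ Finset.HasAntidiagonal.antidiagonal n, s (minimalPeriod σ x) p.1 * nSetCount σ A p.2 := by
      intro x hx
      rw [Set.Finite.mem_toFinset] at hx
      have := congrArg (coeff n) (EX_eq hσ A hA hfin x hx.1 hx.2.1)
      rw [coeff_mul] at this
      simpa only [coeff_mk] using this
    rw [Finset.sum_congr rfl h1, Finset.sum_comm, coeff_mul]
    refine Finset.sum_congr rfl fun p hp => ?_
    rw [← Finset.sum_mul, coeff_mk, coeff_mk]
    congr 1
    have hpn : p.1 ≤ n := by have := Finset.HasAntidiagonal.mem_antidiagonal.1 hp; omega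
    have cnt : ∀ m, 0 < m → m ≤ n → ∑ x ∈ (T_finite A hfin n).toFinset, 
        (if minimalPeriod σ x ∣ m then (1 : ℚ) else 0) = {x | x ∈ A ∧ IsPeriodicPt σ m x}.ncard := by
      intro m hm hmn
      rw [Finset.sum_boole, ← Set.ncard_coe_finset]
      congr 2
      ext x
      simp only [Finset.coe_filter, Set.Finite.mem_toFinset, Set.mem_ofPred_eq, isPeriodicPt_iff_minimalPeriod_dvd]
      refine ⟨fun h => ⟨h.1.1, h.2⟩, fun h => ⟨⟨h.1, Nat.pos_of_dvd_of_pos h.2 hm, (Nat.le_of_dvd hm h.2).trans hmn⟩, h.2⟩⟩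
    rcases Nat.eq_zero_or_pos p.1 with h0 | h0
    · rw [h0, hc0]; simp [s]
    · rw [hc _ h0]
      simp only [s, if_neg h0.ne']
      rw [Finset.sum_sub_distrib, ← Finset.mul_sum, cnt _ h0 hpn]
      congr 2
      split_ifs with h2
      · obtain ⟨r, hr⟩ := h2
        rw [hr, Nat.mul_div_cancel_left r (by norm_num), ← cnt r (by omega) (by omega)]
        simp only [Nat.mul_dvd_mul_iff_left (show 0 < 2 by norm_num)]
      · apply Finset.sum_eq_zero
        intro x _
        rw [if_neg]
        exact fun h => h2 ((Dvd.intro _ rfl).trans h)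
  rw [← key]
  cases n with
  | zero => simp
  | succ n => rw [mul_comm PowerSeries.X, coeff_succ_mul_X, coeff_derivative, coeff_mk]; push_cast; ring
end St9

namespace St9
open Function PowerSeries

/-- Periodic part -/
def w (m : ℕ) : ℚ := if m % 6 = 0 then 2 else if m % 6 = 1 then 1 else if m % 6 = 2 then -1
  else if m % 6 = 3 then -2 else if m % 6 = 4 then -1 else 1

lemma w_rec (m : ℕ) : w (m+2) = w (m+1) - w m := by
  have : m % 6 < 6 := Nat.mod_lt _ (by norm_num)
  unfold w
  rw [Nat.add_mod m 2, Nat.add_mod m 1]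
  interval_cases m % 6 <;> norm_num

/-- coefficients -/
noncomputable def cc (q : ℚ) (m : ℕ) : ℚ := if m = 0 then 0 else
  q^(2*m) - (-q)^m - 2 * (if 2 ∣ m then q^(m/2) else 0) + w m

lemma cc_series (q : ℚ) : ∃ C1 C2 C3 C4 : ℚ⟦X⟧, mk (cc q) = C1 + C2 + C3 + C4 ∧
    C1 * (1 - C (q^2) * X) = C (q^2) * X ∧ C2 * (1 + C q * X) = C q * X ∧
    C3 * (1 - C q * X^2) = - 2 * C q * X^2 ∧ C4 * (1 - X + X^2) = X - 2 * X^2 := by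
  refine ⟨mk fun m => if m = 0 then 0 else (q^2)^m, mk fun m => if m = 0 then 0 else -(-q)^m,
    mk fun m => if m = 0 then 0 else -2 * (if 2 ∣ m then q^(m/2) else 0),
    mk fun m => if m = 0 then 0 else w m, ?_, ?_, ?_, ?_, ?_⟩
  · ext m
    simp only [coeff_mk, map_add, cc]
    split_ifs <;> ring
  · ext m
    rw [show ∀ f : ℚ⟦X⟧, f * (1 - C (q^2) * X) = f - C (q^2) * (f * X) by intros; ring, map_sub,
      coeff_C_mul, coeff_C_mul]
    rcases m with _ | _ | m
    · simp
    · simp [coeff_succ_mul_X]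
    · simp [coeff_succ_mul_X, coeff_X]; ring
  · ext m
    rw [show ∀ f : ℚ⟦X⟧, f * (1 + C q * X) = f + C q * (f * X) by intros; ring, map_add,
      coeff_C_mul, coeff_C_mul]
    rcases m with _ | _ | m
    · simp
    · simp [coeff_succ_mul_X]
    · simp [coeff_succ_mul_X, coeff_X]; ring
  · ext m
    rw [show ∀ f : ℚ⟦X⟧, f * (1 - C q * X^2) = f - C q * (f * X^2) by intros; ring, map_sub,
      show (-2 * C q * X^2 : ℚ⟦X⟧) = C (-2 * q) * X^2 by simp [show (C 2 : ℚ⟦X⟧) = 2 from map_ofNat C 2], coeff_C_mul, coeff_C_mul]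
    rcases m with _ | _ | _ | m
    · simp
    · simp [coeff_mul_X_pow', coeff_X_pow]
    · simp [coeff_mul_X_pow', coeff_X_pow]
    · simp only [coeff_mul_X_pow', coeff_X_pow, coeff_mk]
      have e : (2 ∣ m + 1 + 1 + 1) ↔ 2 ∣ m + 1 := by omega
      have e2 : (m + 1 + 1 + 1) / 2 = (m+1)/2 + 1 := by omega
      simp [e, e2]
      split_ifs <;> ring
  · ext m
    rw [show ∀ f : ℚ⟦X⟧, f * (1 - X + X^2) = f - f * X + f * X^2 by intros; ring, map_add, map_sub,
      show (X - 2 * X^2 : ℚ⟦X⟧) = X - C 2 * X^2 by simp [show (C 2 : ℚ⟦X⟧) = 2 from map_ofNat C 2], map_sub, coeff_C_mul]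
    rcases m with _ | _ | _ | m
    · simp
    · simp [coeff_succ_mul_X, coeff_mul_X_pow', coeff_X_pow, w]
    · simp [coeff_succ_mul_X, coeff_mul_X_pow', coeff_X_pow, coeff_X, w]; norm_num
    · simp [coeff_succ_mul_X, coeff_mul_X_pow', coeff_X_pow, coeff_X]
      have := w_rec (m+1)
      rw [this]; ring

lemma wronskian (U P : ℚ⟦X⟧) (hU : constantCoeff U = 1) (hP : constantCoeff P = 1)
    (h : derivative ℚ U * P = U * derivative ℚ P) : U = P := by
  have hP0 : constantCoeff P ≠ 0 := by rw [hP]; norm_num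
  have hPi : P * P⁻¹ = 1 := PowerSeries.mul_inv_cancel P hP0
  have hV : U * P⁻¹ = 1 := by
    apply PowerSeries.derivative.ext
    · have hd := congrArg (derivative ℚ) hPi
      simp only [Derivation.leibniz, smul_eq_mul, Derivation.map_one_eq_zero] at hd ⊢
      linear_combination (P⁻¹ * P⁻¹) * h + U * P⁻¹ * hd - (U * derivative ℚ P⁻¹ + P⁻¹ * derivative ℚ U)*hPi
    · simp [hU, hP]
  linear_combination P * hV - U * hPi

theorem gf (q : ℚ) (F : ℚ⟦X⟧) (h0 : constantCoeff F = 1)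
    (hF : X * derivative ℚ F = mk (cc q) * F) :
    F * ((1 - X + X^2) * (1 - C (q^2) * X)) = (1 + C q * X) * (1 - C q * X^2) := by
  obtain ⟨C1, C2, C3, C4, hC, h1, h2, h3, h4⟩ := cc_series q
  rw [hC] at hF
  apply wronskian
  · simp [h0]
  · simp
  · apply mul_left_cancel₀ (X_ne_zero (R := ℚ))
    have d2 : derivative ℚ (X^2 : ℚ⟦X⟧) = 2 * X := by
      rw [pow_two]; simp [Derivation.leibniz, derivative_X]; ring
    simp only [Derivation.leibniz, smul_eq_mul, map_add, map_sub, Derivation.map_one_eq_zero, derivative_X, derivative_C, d2]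
    generalize derivative ℚ F = F' at *
    generalize C (q^2) = b at *
    generalize C q = a at *
    linear_combination (1 - X + X^2) * (1 - b * X) * (1 + a*X) * (1 - a*X^2) * hF
      + F * (1 - X + X^2) * (1 + a*X) * (1 - a*X^2) * h1
      + F * (1 - X + X^2) * (1 - b * X) * (1 - a*X^2) * h2
      + F * (1 - X + X^2) * (1 - b * X) * (1 + a*X) * h3
      + F * (1 - b * X) * (1 + a*X) * (1 - a*X^2) * h4

theorem recs (q : ℚ) (a : ℕ → ℚ) 
    (h : mk a * ((1 - X + X^2) * (1 - C (q^2) * X)) = (1 + C q * X) * (1 - C q * X^2)) :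
    a 0 = 1 ∧ a 1 = q^2 + q + 1 ∧ a 2 = q^4 + q^3 + q^2 ∧ a 3 = (q^2+1)*(q^2+q+1)*(q^2-1) ∧
    ∀ m, a (m+4) = (1+q^2) * a (m+3) - (1+q^2) * a (m+2) + q^2 * a (m+1) := by
  obtain ⟨b, hb⟩ : ∃ b : ℚ, b = 1 + q^2 := ⟨_, rfl⟩
  have h' : mk a - C b * (mk a * X^1) + C b * (mk a * X^2) - C (q^2) * (mk a * X^3)
     = 1 + C q * X^1 - C q * X^2 - C (q^2) * X^3 := by
    rw [hb]
    simp only [map_add, map_pow, map_one] at h ⊢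
    linear_combination h
  have hc := fun m => congrArg (coeff m) h'
  simp only [map_add, map_sub, coeff_C_mul, coeff_mul_X_pow' (mk a), coeff_X_pow, coeff_one, coeff_mk] at hc
  have c0 := hc 0
  have c1 := hc 1
  have c2 := hc 2
  have c3 := hc 3
  have c4 := fun m => hc (m+4)
  simp at c0 c1 c2 c3 c4
  subst hb
  have e0 : a 0 = 1 := by linarith
  have e1 : a 1 = q^2 + q + 1 := by rw [e0] at c1; linarith
  have e2 : a 2 = q^4 + q^3 + q^2 := by rw [e0, e1] at c2; linarith
  have e3 : a 3 = (q^2+1)*(q^2+q+1)*(q^2-1) := by rw [e0, e1, e2] at c3; linear_combination c3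
  refine ⟨e0, e1, e2, e3, fun m => ?_⟩
  have := c4 m
  linear_combination this

theorem closed (q : ℚ) (a : ℕ → ℚ) 
    (h1 : a 1 = q^2 + q + 1) (h2 : a 2 = q^4 + q^3 + q^2) (h3 : a 3 = (q^2+1)*(q^2+q+1)*(q^2-1))
    (h : ∀ m, a (m+4) = (1+q^2) * a (m+3) - (1+q^2) * a (m+2) + q^2 * a (m+1)) (j : ℕ) :
    (q^4-q^2+1) * a (3*j+1) = (q^2+q+1) * ((q^2-1)*q^(2*(3*j+1)) + (-1)^j) ∧
    (q^4-q^2+1) * a (3*j+2) = (q^2+q+1) * ((q^2-1)*q^(2*(3*j+2)) + (-1)^j*q^2) ∧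
    (q^4-q^2+1) * a (3*j+3) = (q^3-1)*(q+1) * (q^(2*(3*j+3)) - (-1)^(j+1)) := by
  induction j with
  | zero => simp [h1, h2, h3]; refine ⟨?_, ?_, ?_⟩ <;> ring
  | succ j ih =>
    obtain ⟨i1, i2, i3⟩ := ih
    have k1 := h (3*j)
    have k2 := h (3*j+1)
    have k3 := h (3*j+2)
    rw [show 3*(j+1)+1 = 3*j+4 by ring, show 3*(j+1)+2 = 3*j+5 by ring, show 3*(j+1)+3 = 3*j+6 by ring]
    simp only [add_assoc, Nat.reduceAdd] at k1 k2 k3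
    have r1 : (q^4-q^2+1) * a (3*j+4) = (q^2+q+1) * ((q^2-1)*q^(2*(3*j+4)) + (-1)^(j+1)) := by
      linear_combination (q^4-q^2+1) * k1 + (1+q^2) * i3 - (1+q^2) * i2 + q^2 * i1
    have r2 : (q^4-q^2+1) * a (3*j+5) = (q^2+q+1) * ((q^2-1)*q^(2*(3*j+5)) + (-1)^(j+1)*q^2) := by
      linear_combination (q^4-q^2+1) * k2 + (1+q^2) * r1 - (1+q^2) * i3 + q^2 * i2
    refine ⟨r1, r2, ?_⟩
    linear_combination (q^4-q^2+1) * k3 + (1+q^2) * r2 - (1+q^2) * r1 + q^2 * i3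
end St9

namespace St9
open Function Projectivization

section
variable {k : Type*} [Field k] [Fintype k]


lemma pow_add_inj : ∃ p r : ℕ, p.Prime ∧ CharP (AlgebraicClosure k) p ∧ 0 < r ∧ Fintype.card k = p ^ r := by
  obtain ⟨p, hp⟩ := CharP.exists k
  obtain ⟨r, hp', hr⟩ := FiniteField.card k p
  exact ⟨p, r, hp', charP_of_injective_algebraMap (algebraMap k (AlgebraicClosure k)).injective p, r.pos, hr⟩

lemma frob_inj : Injective (fun x : AlgebraicClosure k => x ^ Fintype.card k) := by
  obtain ⟨p, r, hp, hc, hr, h⟩ := pow_add_inj (k := k)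
  have := Fact.mk hp
  rw [h]
  have := iterateFrobenius_inj (AlgebraicClosure k) p r
  intro x y hxy
  apply this
  simpa [iterateFrobenius_def] using hxy

lemma card_fix (m : ℕ) (hm : 0 < m) :
    {x : AlgebraicClosure k | x ^ (Fintype.card k ^ m) = x}.Finite ∧
    {x : AlgebraicClosure k | x ^ (Fintype.card k ^ m) = x}.ncard = Fintype.card k ^ m := by
  obtain ⟨p, r, hp, hc, hr, h⟩ := pow_add_inj (k := k)
  have h1 : 1 < Fintype.card k ^ m := Nat.one_lt_pow hm.ne' Fintype.one_lt_card
  have hpd : p ∣ Fintype.card k ^ m := by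
    rw [h]; exact dvd_pow (dvd_pow_self p hr.ne') hm.ne'
  generalize Fintype.card k ^ m = N at *
  have hs : {x : AlgebraicClosure k | x ^ N = x} =
      (Polynomial.X ^ N - Polynomial.X : Polynomial (AlgebraicClosure k)).rootSet (AlgebraicClosure k) := by
    ext x
    rw [Polynomial.mem_rootSet]
    simp [sub_eq_zero, FiniteField.X_pow_card_sub_X_ne_zero (AlgebraicClosure k) h1]
  rw [hs]
  refine ⟨Set.toFinite _, ?_⟩
  rw [Set.ncard_eq_toFinset_card', Set.toFinset_card,
    Polynomial.card_rootSet_eq_natDegree (galois_poly_separable p _ hpd) (IsAlgClosed.splits _),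
    FiniteField.X_pow_card_sub_X_natDegree_eq _ h1]

lemma pow_vec_ne {N : ℕ} {v : Fin 3 → AlgebraicClosure k} (hv : v ≠ 0) :
    (fun i => v i ^ N) ≠ 0 := by
  intro h
  apply hv
  funext i
  exact eq_zero_of_pow_eq_zero (congrFun h i)

lemma projFrob_mk (v : Fin 3 → AlgebraicClosure k) (hv : v ≠ 0) :
    projFrob k 3 (mk _ v hv) = mk _ (fun i => v i ^ Fintype.card k) (pow_vec_ne hv) := by
  unfold projFrob
  rw [mk_eq_mk_iff']
  obtain ⟨a, ha⟩ := exists_smul_eq_mk_rep (AlgebraicClosure k) v hv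
  refine ⟨(a : AlgebraicClosure k) ^ Fintype.card k, ?_⟩
  funext i
  rw [← ha]
  simp [Units.smul_def, mul_pow]

lemma projFrob_iter (m : ℕ) (v : Fin 3 → AlgebraicClosure k) (hv : v ≠ 0) :
    (projFrob k 3)^[m] (mk _ v hv) = mk _ (fun i => v i ^ (Fintype.card k ^ m)) (pow_vec_ne hv) := by
  induction m with
  | zero => simp
  | succ m ih => 
    rw [iterate_succ_apply', ih, projFrob_mk]
    simp only [← pow_mul, pow_succ]

lemma projFrob_inj : Injective (projFrob k 3) := by
  intro P R h
  induction P using Projectivization.ind with | h v hv =>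
  induction R using Projectivization.ind with | h u hu =>
  rw [projFrob_mk, projFrob_mk, mk_eq_mk_iff'] at h
  rw [mk_eq_mk_iff']
  obtain ⟨a, ha⟩ := h
  obtain ⟨b, rfl⟩ := IsAlgClosed.exists_pow_nat_eq a (Fintype.card_pos (α := k))
  refine ⟨b, ?_⟩
  funext i
  apply frob_inj
  have := congrFun ha i
  simpa [mul_pow] using this

/-- the chart maps -/
noncomputable def f1 (x : AlgebraicClosure k × AlgebraicClosure k) : Projectivization (AlgebraicClosure k) (Fin 3 → AlgebraicClosure k) :=
  mk _ ![1, x.1, x.2] (fun h => one_ne_zero (congrFun h 0))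
/-- second chart -/
noncomputable def f2 (x : AlgebraicClosure k) : Projectivization (AlgebraicClosure k) (Fin 3 → AlgebraicClosure k) :=
  mk _ ![0, 1, x] (fun h => one_ne_zero (congrFun h 1))
/-- third chart -/
noncomputable def f3 : Projectivization (AlgebraicClosure k) (Fin 3 → AlgebraicClosure k) :=
  mk _ ![0, 0, 1] (fun h => one_ne_zero (congrFun h 2))

lemma f1_inj : Injective (f1 (k := k)) := by
  rintro ⟨x, y⟩ ⟨x', y'⟩ h
  unfold f1 at h
  rw [mk_eq_mk_iff'] at h
  obtain ⟨a, ha⟩ := h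
  have h0 := congrFun ha 0
  have h1 := congrFun ha 1
  have h2 := congrFun ha 2
  simp at h0 h1 h2
  subst h0
  simp at h1 h2
  simp [h1, h2]

lemma f2_inj : Injective (f2 (k := k)) := by
  rintro x x' h
  unfold f2 at h
  rw [mk_eq_mk_iff'] at h
  obtain ⟨a, ha⟩ := h
  have h1 := congrFun ha 1
  have h2 := congrFun ha 2
  simp at h1 h2
  subst h1
  simp at h2
  simp [h2]

lemma f12 (x : AlgebraicClosure k × AlgebraicClosure k) (y : AlgebraicClosure k) : f1 x ≠ f2 y := by
  intro h
  unfold f1 f2 at h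
  rw [mk_eq_mk_iff'] at h
  obtain ⟨a, ha⟩ := h
  have h0 := congrFun ha 0
  simp at h0

lemma f13 (x : AlgebraicClosure k × AlgebraicClosure k) : f1 x ≠ f3 := by
  intro h
  unfold f1 f3 at h
  rw [mk_eq_mk_iff'] at h
  obtain ⟨a, ha⟩ := h
  have h0 := congrFun ha 0
  simp at h0

lemma f23 (x : AlgebraicClosure k) : f2 x ≠ f3 := by
  intro h
  unfold f2 f3 at h
  rw [mk_eq_mk_iff'] at h
  obtain ⟨a, ha⟩ := h
  have h0 := congrFun ha 1
  simp at h0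

lemma cover (P : Projectivization (AlgebraicClosure k) (Fin 3 → AlgebraicClosure k)) :
    (∃ x, P = f1 x) ∨ (∃ x, P = f2 x) ∨ P = f3 := by
  induction P using Projectivization.ind with | h v hv =>
  by_cases h0 : v 0 = 0
  · right
    by_cases h1 : v 1 = 0
    · right
      unfold f3
      rw [mk_eq_mk_iff']
      refine ⟨v 2, ?_⟩
      funext i
      fin_cases i <;> simp [h0, h1]
    · left
      refine ⟨v 2 / v 1, ?_⟩
      unfold f2
      rw [mk_eq_mk_iff']
      refine ⟨v 1, ?_⟩
      funext i
      fin_cases i <;> simp [h0]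
      field_simp
  · left
    refine ⟨(v 1 / v 0, v 2 / v 0), ?_⟩
    unfold f1
    rw [mk_eq_mk_iff']
    refine ⟨v 0, ?_⟩
    funext i
    fin_cases i <;> simp <;> field_simp

lemma N_pos (m : ℕ) : Fintype.card k ^ m ≠ 0 := pow_ne_zero _ Fintype.card_ne_zero

lemma it1 (m : ℕ) (x : AlgebraicClosure k × AlgebraicClosure k) : (projFrob k 3)^[m] (f1 x) =
    f1 (x.1 ^ (Fintype.card k ^ m), x.2 ^ (Fintype.card k ^ m)) := by
  unfold f1
  rw [projFrob_iter]
  congr 1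
  funext i
  fin_cases i <;> simp

lemma it2 (m : ℕ) (x : AlgebraicClosure k) : (projFrob k 3)^[m] (f2 x) =
    f2 (x ^ (Fintype.card k ^ m)) := by
  unfold f2
  rw [projFrob_iter]
  congr 1
  funext i
  fin_cases i <;> simp 

lemma it3 (m : ℕ) : (projFrob k 3)^[m] (f3) = f3 (k := k) := by
  unfold f3
  rw [projFrob_iter]
  congr 1
  funext i
  fin_cases i <;> simp 

lemma card_per (m : ℕ) (hm : 0 < m) :
    {P | IsPeriodicPt (projFrob k 3) m P}.Finite ∧
    {P | IsPeriodicPt (projFrob k 3) m P}.ncard =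
      Fintype.card k ^ m * Fintype.card k ^ m + Fintype.card k ^ m + 1 := by
  obtain ⟨hf, hc⟩ := card_fix (k := k) m hm
  set F := {x : AlgebraicClosure k | x ^ (Fintype.card k ^ m) = x} with hF
  have hs : {P | IsPeriodicPt (projFrob k 3) m P} = (f1 '' (F ×ˢ F) ∪ f2 '' F) ∪ {f3} := by
    ext P
    have hP : P ∈ {P | IsPeriodicPt (projFrob k 3) m P} ↔ (projFrob k 3)^[m] P = P := Iff.rfl
    rw [hP]
    constructor
    · intro h
      rcases cover P with ⟨x, rfl⟩ | ⟨x, rfl⟩ | rfl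
      · rw [it1] at h
        have := f1_inj h
        rw [Prod.ext_iff] at this
        exact Or.inl (Or.inl ⟨x, ⟨this.1, this.2⟩, rfl⟩)
      · rw [it2] at h
        exact Or.inl (Or.inr ⟨x, f2_inj h, rfl⟩)
      · exact Or.inr rfl
    · rintro ((⟨x, ⟨h1, h2⟩, rfl⟩ | ⟨x, h, rfl⟩) | h)
      · rw [it1]; exact congrArg f1 (Prod.ext h1 h2)
      · rw [it2]; exact congrArg f2 h
      · rw [Set.mem_singleton_iff.1 h, it3]
  have g1 : (f1 '' (F ×ˢ F)).Finite := (hf.prod hf).image _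
  have g2 : (f2 '' F).Finite := hf.image _
  rw [hs]
  refine ⟨(g1.union g2).union (Set.finite_singleton _), ?_⟩
  rw [Set.ncard_union_eq ?_ (g1.union g2) (Set.finite_singleton _), Set.ncard_union_eq ?_ g1 g2,
    Set.ncard_image_of_injective _ f1_inj, Set.ncard_image_of_injective _ f2_inj, Set.ncard_prod,
    Set.ncard_singleton, hc]
  · rw [Set.disjoint_left]
    rintro _ ⟨x, _, rfl⟩ ⟨y, _, h⟩
    exact f12 _ _ h.symm
  · rw [Set.disjoint_left]
    rintro _ (⟨x, _, rfl⟩ | ⟨x, _, rfl⟩) h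
    · exact f13 _ h
    · exact f23 _ h

lemma card_perA (Q : Projectivization (AlgebraicClosure k) (Fin 3 → AlgebraicClosure k))
    (hQ3 : projFrob k 3 (projFrob k 3 (projFrob k 3 Q)) = Q)
    (hQcard : ({Q, projFrob k 3 Q, projFrob k 3 (projFrob k 3 Q)} : Set _).ncard = 3)
    (m : ℕ) (hm : 0 < m) : 
    {P | P ∈ ({Q, projFrob k 3 Q, projFrob k 3 (projFrob k 3 Q)} : Set _)ᶜ ∧ 
      IsPeriodicPt (projFrob k 3) m P}.Finite ∧
    {P | P ∈ ({Q, projFrob k 3 Q, projFrob k 3 (projFrob k 3 Q)} : Set _)ᶜ ∧ 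
      IsPeriodicPt (projFrob k 3) m P}.ncard + (if 3 ∣ m then 3 else 0) =
      Fintype.card k ^ m * Fintype.card k ^ m + Fintype.card k ^ m + 1 := by
  obtain ⟨hf, hc⟩ := card_per (k := k) m hm
  have hfA : {P | P ∈ ({Q, projFrob k 3 Q, projFrob k 3 (projFrob k 3 Q)} : Set _)ᶜ ∧ 
      IsPeriodicPt (projFrob k 3) m P}.Finite := hf.subset fun P h => h.2
  refine ⟨hfA, ?_⟩
  rw [← hc]
  have hper : IsPeriodicPt (projFrob k 3) 3 Q := hQ3
  have hnf : ¬ IsFixedPt (projFrob k 3) Q := by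
    intro h
    have h' : projFrob k 3 Q = Q := h
    rw [h', h'] at hQcard
    simp at hQcard
  have : Fact (Nat.Prime 3) := ⟨Nat.prime_three⟩
  have m0 : minimalPeriod (projFrob k 3) Q = 3 := minimalPeriod_eq_prime hper hnf
  have p0 : Q ∈ periodicPts (projFrob k 3) := ⟨3, by norm_num, hper⟩
  have m1 : minimalPeriod (projFrob k 3) (projFrob k 3 Q) = 3 := by rw [minimalPeriod_apply p0, m0]
  have m2 : minimalPeriod (projFrob k 3) (projFrob k 3 (projFrob k 3 Q)) = 3 := by
    have := minimalPeriod_apply_iterate p0 2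
    rw [m0] at this
    exact this
  have hO : ∀ P ∈ ({Q, projFrob k 3 Q, projFrob k 3 (projFrob k 3 Q)} : Set _), 
      (IsPeriodicPt (projFrob k 3) m P ↔ 3 ∣ m) := by
    rintro P (rfl | rfl | rfl) <;> rw [isPeriodicPt_iff_minimalPeriod_dvd]
    · rw [m0]
    · rw [m1]
    · rw [m2]
  generalize ({Q, projFrob k 3 Q, projFrob k 3 (projFrob k 3 Q)} : Set _) = O at *
  have hOf : O.Finite := Set.finite_of_ncard_ne_zero (by omega)
  split_ifs with h3
  · refine Eq.trans (congrArg (_ + ·) hQcard.symm) ?_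
    rw [← Set.ncard_union_eq ?_ hfA hOf]
    · congr 1
      ext P
      constructor
      · rintro (h | h)
        · exact h.2
        · exact (hO P h).2 h3
      · intro h
        by_cases hP : P ∈ O
        · exact Or.inr hP
        · exact Or.inl ⟨hP, h⟩
    · rw [Set.disjoint_left]
      exact fun P h => h.1
  · rw [add_zero]
    congr 1
    ext P
    refine ⟨fun h => h.2, fun h => ⟨fun hP => h3 ((hO P hP).1 h), h⟩⟩

lemma A_stable (Q : Projectivization (AlgebraicClosure k) (Fin 3 → AlgebraicClosure k))
    (hQ3 : projFrob k 3 (projFrob k 3 (projFrob k 3 Q)) = Q) :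
    ∀ P ∈ ({Q, projFrob k 3 Q, projFrob k 3 (projFrob k 3 Q)} : Set _)ᶜ,
      projFrob k 3 P ∈ ({Q, projFrob k 3 Q, projFrob k 3 (projFrob k 3 Q)} : Set _)ᶜ := by
  intro P hP h
  apply hP
  rcases h with h | h | h
  · rw [← hQ3] at h
    exact Or.inr (Or.inr (projFrob_inj h))
  · exact Or.inl (projFrob_inj h)
  · exact Or.inr (Or.inl (projFrob_inj h))
end
end St9

namespace St9
open Function PowerSeries

lemma count_zero {X : Type*} (σ : X → X) (A : Set X) : nSetCount σ A 0 = 1 := by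
  unfold nSetCount
  convert Set.ncard_singleton (∅ : Set X)
  ext S
  constructor
  · rintro ⟨_, h2, h3, _⟩
    exact (Set.ncard_eq_zero h2).1 h3
  · intro h
    rw [Set.mem_singleton_iff.1 h]
    exact ⟨Set.empty_subset _, Set.finite_empty, Set.ncard_empty _, Set.image_empty _⟩

lemma cc_eq (q : ℚ) (N : ℕ → ℚ) (hN : ∀ m, 0 < m → N m + (if 3 ∣ m then 3 else 0) = q^m*q^m + q^m + 1)
    (m : ℕ) (hm : 0 < m) : cc q m = N m - 2 * (if 2 ∣ m then N (m/2) else 0) := by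
  have h1 := hN m hm
  unfold cc
  rw [if_neg hm.ne']
  by_cases h2 : 2 ∣ m
  · obtain ⟨r, rfl⟩ := h2
    have h3 := hN r (by omega)
    simp only [Nat.dvd_mul_right, if_true, Nat.mul_div_cancel_left r (show 0 < 2 by norm_num)]
    have e : (3 ∣ 2 * r) ↔ 3 ∣ r := by omega
    have ew : w (2 * r) = -1 + (if 3 ∣ r then 3 else 0) := by
      unfold w
      have h6 : r % 3 < 3 := Nat.mod_lt _ (by norm_num)
      have hh : (2 * r) % 6 = 2 * (r % 3) := by omega
      simp only [hh, Nat.dvd_iff_mod_eq_zero]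
      interval_cases r % 3 <;> norm_num
    simp only [e] at h1
    have e2 : (-q) ^ (2 * r) = q^(2*r) := by rw [pow_mul, neg_sq, ← pow_mul]
    rw [ew, e2]
    linear_combination -h1 + 2 * h3
  · have ew : w m = 1 - (if 3 ∣ m then 3 else 0) := by
      unfold w
      have h6 : m % 6 < 6 := Nat.mod_lt _ (by norm_num)
      have hh : m % 6 = 1 ∨ m % 6 = 3 ∨ m % 6 = 5 := by omega
      rcases hh with hh | hh | hh
      · simp [hh, show ¬ 3 ∣ m by omega]
      · simp [hh, show 3 ∣ m by omega]; norm_num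
      · simp [hh, show ¬ 3 ∣ m by omega]
    have e2 : (-q) ^ m = - q^m := Odd.neg_pow (Nat.odd_iff.2 (by omega)) q
    rw [ew, e2, if_neg h2, if_neg h2]
    linear_combination -h1

theorem final (k : Type*) [Field k] [Fintype k]
    (Q : Projectivization (AlgebraicClosure k) (Fin 3 → AlgebraicClosure k))
    (hQ3 : projFrob k 3 (projFrob k 3 (projFrob k 3 Q)) = Q)
    (hQcard : ({Q, projFrob k 3 Q, projFrob k 3 (projFrob k 3 Q)} : Set _).ncard = 3) :
    mk (fun n => (nSetCount (projFrob k 3)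
      ({Q, projFrob k 3 Q, projFrob k 3 (projFrob k 3 Q)} : Set _)ᶜ n : ℚ)) *
      ((1 - X + X^2) * (1 - C ((Fintype.card k : ℚ)^2) * X)) =
      (1 + C (Fintype.card k : ℚ) * X) * (1 - C (Fintype.card k : ℚ) * X^2) := by
  have hA := A_stable Q hQ3
  have hN := card_perA Q hQ3 hQcard
  generalize ({Q, projFrob k 3 Q, projFrob k 3 (projFrob k 3 Q)} : Set _)ᶜ = A at *
  apply gf
  · rw [← coeff_zero_eq_constantCoeff_apply, coeff_mk, count_zero]; norm_num
  · apply main_rec projFrob_inj A hA (fun m hm => (hN m hm).1)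
    · simp [cc]
    · intro m hm
      apply cc_eq (Fintype.card k : ℚ)
        (fun m => ({x | x ∈ A ∧ IsPeriodicPt (projFrob k 3) m x}.ncard : ℚ)) _ m hm
      intro m hm
      exact_mod_cast (hN m hm).2
end St9

/-- Let `Q ∈ ℙ²(k̄)` be a point of degree 3 (its σ-orbit
`{Q, σ(Q), σ²(Q)}` has exactly 3 elements) and
`X = ℙ²(k̄) \ {Q, σ(Q), σ²(Q)}`.  For `n > 0`, the number `a(n)` of
`n`-element subsets `S ⊆ X` with `σ(S) = S` is given by the three displayed
formulas according to `n mod 3`. -/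
theorem stmt9 (k : Type*) [Field k] [Fintype k] (q n : ℕ)
    (hq : Fintype.card k = q) (hn : 0 < n)
    (Q : Projectivization (AlgebraicClosure k) (Fin 3 → AlgebraicClosure k))
    (hQ3 : projFrob k 3 (projFrob k 3 (projFrob k 3 Q)) = Q)
    (hQcard : ({Q, projFrob k 3 Q, projFrob k 3 (projFrob k 3 Q)} : Set _).ncard = 3) :
    (n % 3 = 1 →
      (nSetCount (projFrob k 3)
          ({Q, projFrob k 3 Q, projFrob k 3 (projFrob k 3 Q)} : Set _)ᶜ n : ℚ) =
        (((q : ℚ) ^ 2 + q + 1) / ((q : ℚ) ^ 4 - (q : ℚ) ^ 2 + 1)) *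
          (((q : ℚ) ^ 2 - 1) * (q : ℚ) ^ (2 * n) + (-1 : ℚ) ^ ((n - 1) / 3))) ∧
    (n % 3 = 2 →
      (nSetCount (projFrob k 3)
          ({Q, projFrob k 3 Q, projFrob k 3 (projFrob k 3 Q)} : Set _)ᶜ n : ℚ) =
        (((q : ℚ) ^ 2 + q + 1) / ((q : ℚ) ^ 4 - (q : ℚ) ^ 2 + 1)) *
          (((q : ℚ) ^ 2 - 1) * (q : ℚ) ^ (2 * n) +
            (-1 : ℚ) ^ ((n - 2) / 3) * (q : ℚ) ^ 2)) ∧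
    (n % 3 = 0 →
      (nSetCount (projFrob k 3)
          ({Q, projFrob k 3 Q, projFrob k 3 (projFrob k 3 Q)} : Set _)ᶜ n : ℚ) =
        ((((q : ℚ) ^ 3 - 1) * ((q : ℚ) + 1)) / ((q : ℚ) ^ 4 - (q : ℚ) ^ 2 + 1)) *
          ((q : ℚ) ^ (2 * n) - (-1 : ℚ) ^ (n / 3))) := by
  subst hq
  obtain ⟨-, h1, h2, h3, h4⟩ := St9.recs _ _ (St9.final k Q hQ3 hQcard)
  have cl := St9.closed (Fintype.card k : ℚ) (fun n => (nSetCount (projFrob k 3)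
          ({Q, projFrob k 3 Q, projFrob k 3 (projFrob k 3 Q)} : Set _)ᶜ n : ℚ)) h1 h2 h3 h4
  generalize ({Q, projFrob k 3 Q, projFrob k 3 (projFrob k 3 Q)} : Set _)ᶜ = A at *
  have hne : ((Fintype.card k : ℚ)^4 - (Fintype.card k : ℚ)^2 + 1) ≠ 0 := by
    nlinarith [sq_nonneg ((Fintype.card k : ℚ)^2 - 1), sq_nonneg ((Fintype.card k : ℚ)^2)]
  refine ⟨fun hr => ?_, fun hr => ?_, fun hr => ?_⟩
  · obtain ⟨j, rfl⟩ : ∃ j, n = 3 * j + 1 := ⟨n / 3, by omega⟩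
    rw [show (3 * j + 1 - 1) / 3 = j by omega, div_mul_eq_mul_div, eq_div_iff hne, mul_comm]
    exact (cl j).1
  · obtain ⟨j, rfl⟩ : ∃ j, n = 3 * j + 2 := ⟨n / 3, by omega⟩
    rw [show (3 * j + 2 - 2) / 3 = j by omega, div_mul_eq_mul_div, eq_div_iff hne, mul_comm]
    exact (cl j).2.1
  · obtain ⟨j, rfl⟩ : ∃ j, n = 3 * j + 3 := ⟨n / 3 - 1, by omega⟩
    rw [show (3 * j + 3) / 3 = j + 1 by omega, div_mul_eq_mul_div, eq_div_iff hne, mul_comm]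
    exact (cl j).2.2
end

section
/- For every γ ∈ GL_N(𝔽_q), the number of orbits of the cyclic group ⟨γ⟩ acting on k̄^N that are stable under σ (i.e. orbits O with σ(O) = O) equals q^N. Equivalently, the quotient 𝔸^N/⟨γ⟩ has exactly q^N k-rational points. -/
/-- The `q`-power Frobenius acting coordinatewise on `k̄^N`,
where `q = |k|`. -/
noncomputable def afFrob (k : Type*) [Field k] [Fintype k] (N : ℕ) :
    (Fin N → AlgebraicClosure k) → (Fin N → AlgebraicClosure k) :=
  fun v i => (v i) ^ (Fintype.card k)

/-- The matrix `γ ∈ GL_N(𝔽_q)` base-extended to `k̄`. -/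
noncomputable def matK (k : Type*) [Field k] [Fintype k] (N : ℕ)
    (γ : Matrix.GeneralLinearGroup (Fin N) k) :
    Matrix (Fin N) (Fin N) (AlgebraicClosure k) :=
  (γ : Matrix (Fin N) (Fin N) k).map (algebraMap k (AlgebraicClosure k))

/-- The orbit of `P ∈ k̄^N` under the cyclic group generated by
`γ ∈ GL_N(𝔽_q)` (acting `k̄`-linearly via base extension). -/
noncomputable def gOrbit (k : Type*) [Field k] [Fintype k] (N : ℕ)
    (γ : Matrix.GeneralLinearGroup (Fin N) k) (P : Fin N → AlgebraicClosure k) :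
    Set (Fin N → AlgebraicClosure k) :=
  {Q | ∃ i : ℤ, Q = (matK k N (γ ^ i)).mulVec P}

open Polynomial in
theorem mem_range_of_pow_card {k L K : Type*} [Field k] [Field L] [Fintype L] [Field K] [Algebra k L]
    [Algebra k K] (f : L →ₐ[k] K) (x : K) (hx : x ^ Fintype.card L = x) : ∃ y, f y = x := by
  have h1 : (1 : ℕ) < Fintype.card L := Fintype.one_lt_card
  have hs : (X ^ Fintype.card L - X : L[X]).Splits := by
    rw [splits_iff_card_roots, FiniteField.roots_X_pow_card_sub_X,
      FiniteField.X_pow_card_sub_X_natDegree_eq L h1]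
    rfl
  have hr := hs.roots_map (f : L →+* K)
  rw [FiniteField.roots_X_pow_card_sub_X] at hr
  have hx' : x ∈ ((X ^ Fintype.card L - X : L[X]).map (f : L →+* K)).roots := by
    rw [mem_roots]
    · simp [hx]
    · exact (Polynomial.map_ne_zero_iff (f : L →+* K).injective).2
        (FiniteField.X_pow_card_sub_X_ne_zero L h1)
  rw [hr] at hx'
  simpa using hx'

theorem card_twisted_L {k L : Type*} [Field k] [Fintype k] [Field L] [Finite L] [Algebra k L]
    (N : ℕ) (g : Matrix.GeneralLinearGroup (Fin N) k) (hg : orderOf g = Module.finrank k L) :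
    Nat.card {P : Fin N → L // ∀ i, P i ^ Fintype.card k =
      ((g : Matrix (Fin N) (Fin N) k).map (algebraMap k L)).mulVec P i} = Fintype.card k ^ N := by
  classical
  have : Module.Finite k L := inferInstance
  let b := IsGalois.normalBasis k L
  let φ := FiniteField.frobeniusAlgEquivOfAlgebraic k L
  have hφ : ∀ x, φ x = x ^ Fintype.card k := fun x => rfl
  have hgen' : ∀ τ : Gal(L/k), ∃ m : ℕ, φ ^ m = τ := fun τ => by
    obtain ⟨m, hm⟩ := (FiniteField.bijective_frobeniusAlgEquivOfAlgebraic_pow k L).2 τ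
    exact ⟨m, hm⟩
  have hgen : ∀ τ : Gal(L/k), τ ∈ Subgroup.zpowers φ := fun τ => by
    obtain ⟨m, hm⟩ := hgen' τ
    exact ⟨m, by simpa using hm⟩
  let ρ := monoidHomOfForallMemZpowers hgen (g' := g)
    (by rw [hg, FiniteField.orderOf_frobeniusAlgEquivOfAlgebraic])
  have hρ : ρ φ = g := monoidHomOfForallMemZpowers_apply_gen _ _
  have hb : ∀ τ τ' : Gal(L/k), τ (b τ') = b (τ * τ') := fun τ τ' => by
    rw [IsGalois.normalBasis_apply τ', IsGalois.normalBasis_apply (τ * τ')]; rfl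
  have hrepr : ∀ (x : L) (τ : Gal(L/k)), b.repr (φ x) (φ * τ) = b.repr x τ := by
    intro x τ
    conv_lhs => rw [← b.sum_repr x]
    simp [-Module.Basis.sum_repr, map_sum, hb, Finsupp.single_apply]
  have hmul : ∀ (P : Fin N → L) i τ,
      b.repr (((g : Matrix (Fin N) (Fin N) k).map (algebraMap k L)).mulVec P i) τ =
      (g : Matrix (Fin N) (Fin N) k).mulVec (fun j => b.repr (P j) τ) i := by
    intro P i τ
    simp [Matrix.mulVec, dotProduct, ← Algebra.smul_def]
  have key : ∀ P : Fin N → L, (∀ i, P i ^ Fintype.card k =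
      ((g : Matrix (Fin N) (Fin N) k).map (algebraMap k L)).mulVec P i) ↔
      ∀ τ, (fun j => b.repr (P j) τ) =
        (g : Matrix (Fin N) (Fin N) k).mulVec (fun j => b.repr (P j) (φ * τ)) := by
    intro P
    constructor
    · intro h τ
      funext i
      rw [← hmul, ← h i, ← hφ, hrepr]
    · intro h i
      apply b.repr.injective
      ext τ
      obtain ⟨τ, rfl⟩ : ∃ τ', τ = φ * τ' := ⟨φ⁻¹ * τ, by simp⟩
      rw [← hφ, hrepr, hmul, ← h τ]
  have hcard : Nat.card (Fin N → k) = Fintype.card k ^ N := by simp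
  rw [← hcard]
  refine Nat.card_congr (Equiv.ofBijective (fun P i => b.repr (P.1 i) 1) ⟨?_, ?_⟩)
  · rintro ⟨P, hP⟩ ⟨Q, hQ⟩ h
    rw [key] at hP hQ
    have : ∀ m : ℕ, (fun j => b.repr (P j) (φ ^ m)) = (fun j => b.repr (Q j) (φ ^ m)) := by
      intro m
      induction m with
      | zero => simpa using h
      | succ m ih =>
        rw [pow_succ']
        rw [hP, hQ] at ih
        exact Matrix.mulVec_injective_of_isUnit g.isUnit ih
    apply Subtype.ext
    funext i
    apply b.repr.injective
    ext τ
    obtain ⟨m, rfl⟩ := hgen' τ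
    exact congrFun (this m) i
  · intro v
    have hc : ∀ τ i, b.repr (∑ τ', ((ρ τ')⁻¹ : Matrix.GeneralLinearGroup (Fin N) k).1.mulVec v i • b τ') τ
        = ((ρ τ)⁻¹ : Matrix.GeneralLinearGroup (Fin N) k).1.mulVec v i := by
      intro τ i
      rw [Module.Basis.repr_sum_self]
    refine ⟨⟨fun i => ∑ τ, ((ρ τ)⁻¹ : Matrix.GeneralLinearGroup (Fin N) k).1.mulVec v i • b τ, ?_⟩, ?_⟩
    · rw [key]
      intro τ
      simp only [hc]
      change _ = (g : Matrix (Fin N) (Fin N) k).mulVec (((ρ (φ * τ))⁻¹ : Matrix.GeneralLinearGroup (Fin N) k).1.mulVec v)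
      rw [Matrix.mulVec_mulVec, ← Units.val_mul]
      have hcomm : φ * τ = τ * φ := by
        obtain ⟨m, rfl⟩ := hgen' τ
        exact (Commute.self_pow φ m)
      rw [hcomm, map_mul, hρ, mul_inv_rev, mul_inv_cancel_left]
    · funext i
      simp only [hc]
      simp

theorem matK_mul (k : Type*) [Field k] [Fintype k] (N : ℕ) (g h : Matrix.GeneralLinearGroup (Fin N) k) :
    matK k N (g * h) = matK k N g * matK k N h := by
  simp [matK, Matrix.map_mul]

theorem matK_one (k : Type*) [Field k] [Fintype k] (N : ℕ) :
    matK k N 1 = 1 := by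
  simp [matK]

theorem afFrob_mulVec (k : Type*) [Field k] [Fintype k] (N : ℕ)
    (g : Matrix.GeneralLinearGroup (Fin N) k) (P : Fin N → AlgebraicClosure k) :
    afFrob k N ((matK k N g).mulVec P) = (matK k N g).mulVec (afFrob k N P) := by
  funext i
  change FiniteField.frobeniusAlgHom k (AlgebraicClosure k) (∑ j, matK k N g i j * P j) =
    ∑ j, matK k N g i j * FiniteField.frobeniusAlgHom k (AlgebraicClosure k) (P j)
  rw [map_sum]
  refine Finset.sum_congr rfl fun j _ => ?_
  rw [map_mul]
  congr 1
  exact (FiniteField.frobeniusAlgHom k (AlgebraicClosure k)).commutes _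

theorem card_twisted (k : Type*) [Field k] [Fintype k] (N : ℕ)
    (g : Matrix.GeneralLinearGroup (Fin N) k) :
    Nat.card {P : Fin N → AlgebraicClosure k // afFrob k N P = (matK k N g).mulVec P}
      = Fintype.card k ^ N := by
  obtain ⟨p, hp⟩ := CharP.exists k
  have : Fact (Nat.Prime p) := ⟨CharP.char_is_prime k p⟩
  have : NeZero (orderOf g) := ⟨(orderOf_pos g).ne'⟩
  let L := FiniteField.Extension k p (orderOf g)
  have hL : Module.finrank k L = orderOf g := FiniteField.finrank_extension k p _
  have : Fintype L := Fintype.ofFinite L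
  have hcL : Fintype.card L = Fintype.card k ^ orderOf g := by
    rw [← Nat.card_eq_fintype_card, ← Nat.card_eq_fintype_card]
    exact FiniteField.natCard_extension k p _
  rw [← card_twisted_L (L := L) N g hL.symm]
  let f : L →ₐ[k] AlgebraicClosure k := IsAlgClosed.lift
  have hf : ∀ (P : Fin N → L), (matK k N g).mulVec (fun i => f (P i)) =
      fun i => f (((g : Matrix (Fin N) (Fin N) k).map (algebraMap k L)).mulVec P i) := by
    intro P
    funext i
    simp [matK, Matrix.mulVec, dotProduct]
  symm
  refine Nat.card_congr (Equiv.ofBijective (fun P => ⟨fun i => f (P.1 i), ?_⟩) ⟨?_, ?_⟩)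
  · rw [hf]
    funext i
    rw [← P.2 i, map_pow]; rfl
  · intro P Q h
    apply Subtype.ext
    funext i
    exact f.toRingHom.injective (congrFun (congrArg Subtype.val h) i)
  · rintro ⟨P, hP⟩
    have hit : ∀ m : ℕ, (fun i => P i ^ Fintype.card k ^ m) = (matK k N (g ^ m)).mulVec P := by
      intro m
      induction m with
      | zero => simp [matK_one]
      | succ m ih =>
        rw [pow_succ g m, matK_mul, ← Matrix.mulVec_mulVec, ← hP, ← afFrob_mulVec, ← ih]
        funext i
        simp [afFrob, pow_succ, pow_mul]
    have h1 := hit (orderOf g)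
    rw [pow_orderOf_eq_one, matK_one, Matrix.one_mulVec] at h1
    have h2 : ∀ i, ∃ y, f y = P i := fun i =>
      mem_range_of_pow_card f (P i) (by rw [hcL]; exact congrFun h1 i)
    choose Q hQ using h2
    refine ⟨⟨Q, ?_⟩, ?_⟩
    · intro i
      apply f.toRingHom.injective
      have := congrFun (hf Q) i
      change f _ = f _
      rw [← this]
      simp only [hQ, ← hP, map_pow]; rfl
    · apply Subtype.ext
      funext i
      exact hQ i

/-- The action of the general linear group on `k̄^N`. -/
noncomputable abbrev glAct (k : Type*) [Field k] [Fintype k] (N : ℕ) :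
    MulAction (Matrix.GeneralLinearGroup (Fin N) k) (Fin N → AlgebraicClosure k) where
  smul g P := (matK k N g).mulVec P
  one_smul P := by change (matK k N 1).mulVec P = P; simp [matK_one]
  mul_smul g h P := by
    change (matK k N (g * h)).mulVec P = (matK k N g).mulVec ((matK k N h).mulVec P)
    simp [matK_mul]

/-- Abstract Burnside count. -/
theorem burnside_twist {G V : Type*} [Group G] [Finite G] [MulAction G V] (s : V → V)
    (hcomm : ∀ a b : G, a * b = b * a)
    (hs : ∀ (g : G) v, s (g • v) = g • s v) (c : ℕ) (hc0 : c ≠ 0)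
    (hc : ∀ g : G, Nat.card {v // s v = g • v} = c) :
    Set.ncard {O : Set V | (∃ v, O = MulAction.orbit G v) ∧ s '' O = O} = c := by
  classical
  let X : SubMulAction G V :=
    { carrier := {v | ∃ g : G, s v = g • v}
      smul_mem' := by
        rintro h v ⟨g, hg⟩
        exact ⟨g, by rw [hs, hg, smul_smul, smul_smul, hcomm]⟩ }
  have hX : ∀ x : X, ∃ g : G, s x.1 = g • x.1 := fun x => x.2
  choose t ht using hX
  have hstab : ∀ v : V, s '' MulAction.orbit G v = MulAction.orbit G v ↔ v ∈ X := by
    intro v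
    constructor
    · intro h
      have : s v ∈ MulAction.orbit G v := h ▸ ⟨v, MulAction.mem_orbit_self v, rfl⟩
      obtain ⟨g, hg⟩ := this
      exact ⟨g, hg.symm⟩
    · rintro ⟨g, hg⟩
      ext w
      constructor
      · rintro ⟨_, ⟨h, rfl⟩, rfl⟩
        exact ⟨h * g, by simp [hs, hg, mul_smul]⟩
      · rintro ⟨h, rfl⟩
        exact ⟨(h * g⁻¹) • v, ⟨_, rfl⟩, by simp [hs, hg, mul_smul]⟩
  let e1 : (Σ g : G, {v // s v = g • v}) ≃ (Σ g : G, MulAction.fixedBy X g) :=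
    { toFun := fun x => ⟨(t ⟨x.2.1, x.1, x.2.2⟩)⁻¹ * x.1, ⟨x.2.1, x.1, x.2.2⟩, by
        apply Subtype.ext
        change ((t ⟨x.2.1, x.1, x.2.2⟩)⁻¹ * x.1) • x.2.1 = x.2.1
        rw [mul_smul, ← x.2.2, inv_smul_eq_iff, ← ht]⟩
      invFun := fun y => ⟨t y.2.1 * y.1, y.2.1.1, by
        have h : y.1 • y.2.1.1 = y.2.1.1 := congrArg Subtype.val y.2.2
        rw [mul_smul, h, ← ht]⟩
      left_inv := by
        rintro ⟨g, v, hv⟩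
        refine Sigma.subtype_ext ?_ rfl
        simp
      right_inv := by
        rintro ⟨g, v, hv⟩
        refine Sigma.subtype_ext ?_ rfl
        simp }
  let e2 : MulAction.orbitRel.Quotient G X ≃
      {O : Set V | (∃ v, O = MulAction.orbit G v) ∧ s '' O = O} :=
    Equiv.ofBijective (Quotient.lift (fun x : X => ⟨MulAction.orbit G x.1, ⟨_, rfl⟩, (hstab _).2 x.2⟩)
      (by
        rintro x y ⟨g, hg⟩
        apply Subtype.ext
        exact MulAction.orbit_eq_iff.2 ⟨g, congrArg Subtype.val hg⟩))
      ⟨by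
        rintro ⟨x⟩ ⟨y⟩ h
        apply Quotient.sound
        obtain ⟨g, hg⟩ := MulAction.orbit_eq_iff.1 (congrArg Subtype.val h)
        exact ⟨g, Subtype.ext hg⟩, by
        rintro ⟨_, ⟨v, rfl⟩, h⟩
        exact ⟨Quotient.mk _ ⟨v, (hstab v).1 h⟩, rfl⟩⟩
  have h1 := Nat.card_congr (e1.trans (MulAction.sigmaFixedByEquivOrbitsProdGroup G X))
  have : Fintype G := Fintype.ofFinite G
  have : ∀ g : G, Finite {v // s v = g • v} := fun g =>
    Nat.finite_of_card_ne_zero (by rw [hc]; exact hc0)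
  rw [Nat.card_prod, Nat.card_congr e2, Nat.card_sigma] at h1
  simp only [hc, Finset.sum_const, smul_eq_mul, Finset.card_univ, Nat.card_eq_fintype_card (α := G)] at h1
  rw [← Nat.card_coe_set_eq]
  rw [mul_comm] at h1
  exact (Nat.eq_of_mul_eq_mul_right Fintype.card_pos h1).symm

/-- For every `γ ∈ GL_N(𝔽_q)`, the number of `⟨γ⟩`-orbits on `k̄^N`
stable under `σ` equals `q^N`; i.e. `𝔸^N/⟨γ⟩` has exactly `q^N`
`k`-rational points. -/
theorem stmt13 (k : Type*) [Field k] [Fintype k] (q N : ℕ)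
    (hq : Fintype.card k = q)
    (γ : Matrix.GeneralLinearGroup (Fin N) k) :
    Set.ncard {O : Set (Fin N → AlgebraicClosure k) |
      (∃ P, O = gOrbit k N γ P) ∧ afFrob k N '' O = O} = q ^ N := by
  subst hq
  let := glAct k N
  have horb : ∀ P, gOrbit k N γ P = MulAction.orbit (Subgroup.zpowers γ) P := by
    intro P
    ext Q
    constructor
    · rintro ⟨i, rfl⟩
      exact ⟨⟨γ ^ i, i, rfl⟩, rfl⟩
    · rintro ⟨⟨_, i, rfl⟩, rfl⟩
      exact ⟨i, rfl⟩
  simp only [horb]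
  exact burnside_twist (G := Subgroup.zpowers γ) (afFrob k N)
    (fun a b => by
      obtain ⟨_, i, rfl⟩ := a
      obtain ⟨_, j, rfl⟩ := b
      apply Subtype.ext
      exact (Commute.refl γ).zpow_zpow i j)
    (fun g v => afFrob_mulVec k N g.1 v) _
    (pow_ne_zero _ Fintype.card_ne_zero) (fun g => card_twisted k N g.1)
end
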